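/- arXiv:2003.00841 — 4 statements merged into one kernel-verified Lean document; each statement's English description precedes it below -/
import Mathlib

section
/- Let p ∈ ℂ^n and μ ∈ ℝ. Let g = (b + ⟨β,β⟩_q)/(c + ⟨γ,γ⟩_r), where b, c ∈ ℝ, β and γ are tuples of holomorphic functions defined on a neighborhood of p vanishing at p, and the denominator c + ⟨γ,γ⟩_r does not vanish at p. Suppose there exist a ∈ ℝ and a tuple α of holomorphic functions vanishing at p such that f := a + ⟨α,α⟩_ℓ is positive on a neighborhood of p, and d, e ∈ ℝ and tuples δ, ε of holomorphic functions vanishing at p with e + ⟨ε,ε⟩_v nonvanishing at p, such that e^{g(z)} = f(z)^μ · (d + ⟨δ(z),δ(z)⟩_u)/(e + ⟨ε(z),ε(z)⟩_v) for all z in a neighborhood of p. Then g is constant on a neighborhood of p. -/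
open Filter Topology Complex

/-- `⟨α,α⟩_ℓ(z) = Σ_{j<ℓ} |α_j(z)|² − Σ_{j≥ℓ} |α_j(z)|²` (0-indexed), real valued. -/
noncomputable def hermR {n m : ℕ} (ℓ : ℕ) (α : Fin m → (Fin n → ℂ) → ℂ)
    (z : Fin n → ℂ) : ℝ :=
  ∑ j : Fin m, (if (j : ℕ) < ℓ then (1 : ℝ) else -1) * Complex.normSq (α j z)

section

open Polynomial TensorProduct KaehlerDifferential

lemma formallyEtale_polynomial (M K : Type*) [Field M] [CharZero M] [Field K]
    [Algebra M[X] K] [Algebra (RatFunc M) K] [IsScalarTower M[X] (RatFunc M) K]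
    [Algebra.IsAlgebraic (RatFunc M) K] : Algebra.FormallyEtale M[X] K := by
  have : CharZero (RatFunc M) := charZero_of_injective_algebraMap (algebraMap M (RatFunc M)).injective
  have h1 : Algebra.FormallyEtale M[X] (RatFunc M) :=
    Algebra.FormallyEtale.of_isLocalization (nonZeroDivisors M[X])
  have h2 : Algebra.FormallyEtale (RatFunc M) K := Algebra.FormallyEtale.of_isSeparable _ _
  exact Algebra.FormallyEtale.comp _ (RatFunc M) _

lemma exists_derivation_eq_one (M K : Type*) [Field M] [Field K] [Algebra M K]
    [Algebra M[X] K] [IsScalarTower M M[X] K] [Algebra.FormallyEtale M[X] K] :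
    ∃ D : Derivation M K K, D (algebraMap M[X] K X) = 1 := by
  let d : Derivation M M[X] K := mkDerivation M (1 : K)
  let e := tensorKaehlerEquivOfFormallyEtale M M[X] K
  refine ⟨((d.liftKaehlerDifferential.liftBaseChange K) ∘ₗ e.symm.toLinearMap).compDer
    (KaehlerDifferential.D M K), ?_⟩
  have h := tensorKaehlerEquivOfFormallyEtale_symm_D_algebraMap M M[X] K X
  simp [e, h, d, mkDerivation_X]

lemma derivation_eq_zero_of_X (M E V : Type*) [Field M] [Field E] [Algebra M E]
    [Algebra M[X] E] [IsScalarTower M M[X] E] [Algebra.FormallyUnramified M[X] E]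
    [AddCommGroup V] [Module E V] [Module M V] [IsScalarTower M E V]
    (D : Derivation M E V) (h : D (algebraMap M[X] E X) = 0) (x : E) : D x = 0 := by
  let : Module M[X] V := Module.compHom V (algebraMap M[X] E)
  have : IsScalarTower M[X] E V := ⟨fun p e v => by
    rw [Algebra.smul_def, mul_smul]; rfl⟩
  have : IsScalarTower M M[X] V := ⟨fun p e v => by
    rw [← algebraMap_smul E, ← algebraMap_smul E e v, ← algebraMap_smul E p (_ : V), smul_smul,
      Algebra.smul_def, map_mul, ← IsScalarTower.algebraMap_apply]⟩
  have h0 : ∀ p : M[X], D (algebraMap M[X] E p) = 0 := by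
    have : (D.compAlgebraMap M[X] : Derivation M M[X] V) = 0 := by
      apply Polynomial.derivation_ext
      simpa using h
    intro p
    exact DFunLike.congr_fun this p
  let D' : Derivation M[X] E V :=
    Derivation.mk'
      { toFun := D
        map_add' := D.map_add
        map_smul' := fun (p : M[X]) e => by
          simp only [Algebra.smul_def, D.leibniz, h0, smul_zero, add_zero]
          rfl }
      (fun a b => D.leibniz a b)
  have : D'.liftKaehlerDifferential = 0 := by
    exact LinearMap.ext fun y => by rw [Subsingleton.elim y 0, map_zero, map_zero]
  have h2 := D'.liftKaehlerDifferential_comp_D x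
  rw [this] at h2
  exact h2.symm

lemma derivation_prod_div {M K ι : Type*} [Field M] [Field K] [Algebra M K] (D : Derivation M K K)
    (s : Finset ι) (f : ι → K) (hf : ∀ i ∈ s, f i ≠ 0) :
    D (∏ i ∈ s, f i) / ∏ i ∈ s, f i = ∑ i ∈ s, D (f i) / f i := by
  classical
  induction s using Finset.induction_on with
  | empty => simp
  | insert a s ha ih =>
    have h1 : f a ≠ 0 := hf a (by simp)
    have h2 : ∏ i ∈ s, f i ≠ 0 := Finset.prod_ne_zero_iff.2 fun i hi => hf i (by simp [hi])
    rw [Finset.prod_insert ha, Finset.sum_insert ha, ← ih fun i hi => hf i (by simp [hi]),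
      D.leibniz]
    simp only [smul_eq_mul]
    field_simp
    ring

lemma derivation_div_div {M K : Type*} [Field M] [Field K] [Algebra M K] (D : Derivation M K K)
    {a b : K} (ha : a ≠ 0) (hb : b ≠ 0) : D (a / b) / (a / b) = D a / a - D b / b := by
  rw [Derivation.leibniz_div]
  simp only [smul_eq_mul]
  field_simp

lemma sum_logDeriv_polynomial_ne_natCast {M K ι : Type*} [Field M] [CharZero M] [Field K]
    [Algebra M K] [Algebra M[X] K] [IsScalarTower M M[X] K]
    (hinj : Function.Injective (algebraMap M[X] K)) (D : Derivation M K K)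
    (hD : D (algebraMap M[X] K X) = 1) (s : Finset ι) (c : ι → M) (P : ι → M[X])
    (hP : ∀ i ∈ s, P i ≠ 0) (n : ℕ) (hn : n ≠ 0) :
    ∑ i ∈ s, c i • (D (algebraMap M[X] K (P i)) / algebraMap M[X] K (P i)) ≠ n := by
  classical
  intro h
  have hDp : ∀ p : M[X], D (algebraMap M[X] K p) = algebraMap M[X] K (derivative p) := by
    intro p
    have h1 : algebraMap M[X] K p = aeval (algebraMap M[X] K X) p := by
      rw [aeval_algebraMap_apply, aeval_X_left_apply]
    have h2 : algebraMap M[X] K (derivative p) = aeval (algebraMap M[X] K X) (derivative p) := by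
      rw [aeval_algebraMap_apply, aeval_X_left_apply]
    rw [h1, Derivation.map_aeval, hD, h2, smul_eq_mul, mul_one]
  have key : ∑ i ∈ s, c i • (derivative (P i) * ∏ j ∈ s.erase i, P j) = (n : M[X]) * ∏ j ∈ s, P j := by
    apply hinj
    rw [map_mul, map_natCast, ← h, Finset.sum_mul, map_sum]
    refine Finset.sum_congr rfl fun i hi => ?_
    have hi0 : algebraMap M[X] K (P i) ≠ 0 := by
      rw [Ne, map_eq_zero_iff _ hinj]; exact hP i hi
    rw [← Finset.mul_prod_erase s P hi, hDp, Algebra.smul_def, Algebra.smul_def, map_mul, map_mul,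
      map_mul, ← IsScalarTower.algebraMap_apply]
    field_simp
  have hprod : ∏ j ∈ s, P j ≠ 0 := Finset.prod_ne_zero_iff.2 hP
  have hmem : (n : M[X]) * ∏ j ∈ s, P j ∈ degreeLT M (∏ j ∈ s, P j).natDegree := by
    rw [← key]
    refine Submodule.sum_mem _ fun i hi => Submodule.smul_mem _ _ ?_
    rw [mem_degreeLT, ← degree_eq_natDegree hprod, ← Finset.mul_prod_erase s P hi, degree_mul,
      degree_mul]
    have h3 : (∏ j ∈ s.erase i, P j).degree ≠ ⊥ := by
      rw [Ne, degree_eq_bot]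
      exact Finset.prod_ne_zero_iff.2 fun j hj => hP j (Finset.mem_of_mem_erase hj)
    exact WithBot.add_lt_add_right h3 (degree_derivative_lt (hP i hi))
  rw [mem_degreeLT, ← degree_eq_natDegree hprod, degree_mul, ← C_eq_natCast,
    degree_C (by exact_mod_cast hn), zero_add] at hmem
  exact lt_irrefl _ hmem

lemma exists_derivation_sum_logDeriv_ne_one (M E : Type*) [Field M] [CharZero M] [Field E]
    [Algebra M E] [Algebra M[X] E] [IsScalarTower M M[X] E] [Algebra (RatFunc M) E]
    [IsScalarTower M[X] (RatFunc M) E] [FiniteDimensional (RatFunc M) E] :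
    ∃ D : Derivation M E E, ∀ {ι : Type} (s : Finset ι) (c : ι → M) (u : ι → E),
      (∀ i ∈ s, u i ≠ 0) →
      ∑ i ∈ s, c i • (D (u i) / u i) ≠ D (algebraMap M[X] E X) := by
  classical
  have : CharZero (RatFunc M) := charZero_of_injective_algebraMap (algebraMap M (RatFunc M)).injective
  have hE := formallyEtale_polynomial M E
  let K := AlgebraicClosure (RatFunc M)
  have hK := formallyEtale_polynomial M K
  obtain ⟨D, hD⟩ := exists_derivation_eq_one M E
  obtain ⟨DK, hDK⟩ := exists_derivation_eq_one M K
  have hinj : Function.Injective (algebraMap M[X] K) := by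
    rw [IsScalarTower.algebraMap_eq M[X] (RatFunc M) K]
    exact (algebraMap (RatFunc M) K).injective.comp (RatFunc.algebraMap_injective M)
  have hX : ∀ (σ : E →ₐ[RatFunc M] K) (p : M[X]), σ (algebraMap M[X] E p) = algebraMap M[X] K p := by
    intro σ p
    rw [IsScalarTower.algebraMap_apply M[X] (RatFunc M) E, σ.commutes,
      ← IsScalarTower.algebraMap_apply]
  have hM : ∀ (σ : E →ₐ[RatFunc M] K) (m : M), σ (algebraMap M E m) = algebraMap M K m := by
    intro σ m
    rw [IsScalarTower.algebraMap_apply M M[X] E, hX, ← IsScalarTower.algebraMap_apply]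
  have hσ : ∀ (σ : E →ₐ[RatFunc M] K) (x : E), DK (σ x) = σ (D x) := by
    intro σ x
    have hsm : ∀ (m : M) (a : E), σ (m • a) = m • σ a := fun m a => by
      simp only [Algebra.smul_def, map_mul, hM]
    let _ : Module E K := Module.compHom K σ.toRingHom
    have hs : ∀ (e : E) (k : K), e • k = σ e * k := fun _ _ => rfl
    have : IsScalarTower M E K := ⟨fun m e k => by
      simp only [hs, Algebra.smul_def, map_mul, hM, mul_assoc]⟩
    let d : Derivation M E K := Derivation.mk'
      { toFun := fun x => DK (σ x) - σ (D x)
        map_add' := fun a b => by simp only [map_add]; ring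
        map_smul' := fun m a => by
          simp only [hsm, Derivation.map_smul, smul_sub, RingHom.id_apply] }
      (fun a b => by
        simp only [LinearMap.coe_mk, AddHom.coe_mk, hs, map_mul, Derivation.leibniz,
          smul_eq_mul, map_add]
        ring)
    have := derivation_eq_zero_of_X M E K d (by
      change DK (σ _) - σ (D _) = 0
      rw [hX, hDK, hD, map_one, sub_self]) x
    exact sub_eq_zero.1 this
  refine ⟨D, fun {ι} s c u hu h => ?_⟩
  rw [hD] at h
  let N : ι → RatFunc M := fun i => Algebra.norm (RatFunc M) (u i)
  have hN : ∀ i, algebraMap (RatFunc M) K (N i) = ∏ σ : E →ₐ[RatFunc M] K, σ (u i) :=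
    fun i => Algebra.norm_eq_prod_embeddings (RatFunc M) K (u i)
  have hN0 : ∀ i ∈ s, N i ≠ 0 := fun i hi => Algebra.norm_ne_zero_iff.2 (hu i hi)
  have hsum : ∑ i ∈ s, c i • (DK (algebraMap (RatFunc M) K (N i)) / algebraMap (RatFunc M) K (N i))
      = (Fintype.card (E →ₐ[RatFunc M] K) : K) := by
    have : ∀ σ : E →ₐ[RatFunc M] K, ∑ i ∈ s, c i • (DK (σ (u i)) / σ (u i)) = 1 := by
      intro σ
      rw [← map_one σ, ← h, map_sum]
      refine Finset.sum_congr rfl fun i hi => ?_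
      simp only [Algebra.smul_def, map_mul, hM, map_div₀, hσ]
    rw [← Finset.card_univ, ← nsmul_one, ← Finset.sum_const,
      ← Finset.sum_congr rfl fun σ _ => this σ, Finset.sum_comm]
    refine Finset.sum_congr rfl fun i hi => ?_
    rw [hN, derivation_prod_div, Finset.smul_sum]
    intro σ _
    simpa using hu i hi
  have hfrac : ∀ i ∈ s, DK (algebraMap (RatFunc M) K (N i)) / algebraMap (RatFunc M) K (N i) =
      DK (algebraMap M[X] K (N i).num) / algebraMap M[X] K (N i).num -
      DK (algebraMap M[X] K (N i).denom) / algebraMap M[X] K (N i).denom := by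
    intro i hi
    have h1 : algebraMap (RatFunc M) K (N i) =
        algebraMap M[X] K (N i).num / algebraMap M[X] K (N i).denom := by
      conv_lhs => rw [← RatFunc.num_div_denom (N i)]
      rw [map_div₀, ← IsScalarTower.algebraMap_apply, ← IsScalarTower.algebraMap_apply]
    have h2 : algebraMap M[X] K (N i).num ≠ 0 := by
      rw [Ne, map_eq_zero_iff _ hinj]; exact RatFunc.num_ne_zero (hN0 i hi)
    have h3 : algebraMap M[X] K (N i).denom ≠ 0 := by
      rw [Ne, map_eq_zero_iff _ hinj]; exact RatFunc.denom_ne_zero _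
    rw [h1, derivation_div_div _ h2 h3]
  refine sum_logDeriv_polynomial_ne_natCast hinj DK hDK (s.disjSum s) (Sum.elim c (fun i => -c i))
    (Sum.elim (fun i => (N i).num) (fun i => (N i).denom)) ?_
    (Fintype.card (E →ₐ[RatFunc M] K)) ?_ ?_
  · intro i hi
    rcases i with i | i
    · exact RatFunc.num_ne_zero (hN0 i (by simpa using hi))
    · exact RatFunc.denom_ne_zero _
  · have : Nonempty (E →ₐ[RatFunc M] K) := ⟨IsAlgClosed.lift⟩
    exact Fintype.card_ne_zero
  · rw [← hsum, Finset.sum_disjSum, ← Finset.sum_add_distrib]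
    refine Finset.sum_congr rfl fun i hi => ?_
    simp only [Sum.elim_inl, Sum.elim_inr]
    rw [hfrac i hi, smul_sub, neg_smul, sub_eq_add_neg]

lemma isAlgebraic_of_ringHom {A B E : Type*} [Field A] [Field B] [Field E] [Algebra A E]
    [Algebra B E] [Algebra.IsAlgebraic A E] (f : A →+* B)
    (hf : ∀ x, algebraMap B E (f x) = algebraMap A E x) : Algebra.IsAlgebraic B E := by
  refine ⟨fun x => ?_⟩
  obtain ⟨p, hp0, hp⟩ := Algebra.IsAlgebraic.isAlgebraic (R := A) x
  refine ⟨p.map f, by rwa [Ne, Polynomial.map_eq_zero_iff f.injective], ?_⟩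
  rw [aeval_def, eval₂_map, ← hp, aeval_def]
  congr 1
  exact RingHom.ext hf

open IntermediateField algebraAdjoinAdjoin in
lemma exists_derivation_sum_logDeriv_ne {k E : Type*} [Field k] [CharZero k] [Field E]
    [Algebra k E] [Algebra.EssFiniteType k E] {G : E} (hG : Transcendental k G) :
    ∃ D : Derivation k E E, ∀ {ι : Type} (s : Finset ι) (c : ι → k) (u : ι → E),
      (∀ i ∈ s, u i ≠ 0) → ∑ i ∈ s, c i • (D (u i) / u i) ≠ D G := by
  obtain ⟨t, hGt, ht⟩ := exists_isTranscendenceBasis_superset (R := k) (s := {G})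
    (by simpa [algebraicIndependent_unique_type_iff, AlgebraicIndepOn] using hG)
  have hGt : G ∈ t := hGt rfl
  let M := IntermediateField.adjoin k (t \ {G})
  have hGM : Transcendental M G := by
    have h1 := ht.1.transcendental_adjoin (s := {i | (i : E) ≠ G}) (i := ⟨G, hGt⟩) (by simp)
    have h2 : (Set.image Subtype.val {i : t | (i : E) ≠ G}) = t \ {G} := by
      ext x; simp [and_comm]
    rw [h2] at h1
    intro h
    apply h1
    exact (IsFractionRing.isAlgebraic_iff (Algebra.adjoin k (t \ {G})) M E).2 h
  have halg : Algebra.IsAlgebraic M⟮G⟯ E := by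
    have h1 := ht.isAlgebraic_field
    rw [Subtype.range_coe] at h1
    have hle : IntermediateField.adjoin k t ≤ (M⟮G⟯).restrictScalars k := by
      rw [IntermediateField.adjoin_le_iff]
      intro x hx
      by_cases hxG : x = G
      · subst hxG
        exact mem_adjoin_simple_self M x
      · have : x ∈ M := subset_adjoin k _ ⟨hx, hxG⟩
        exact (M⟮G⟯).algebraMap_mem ⟨x, this⟩
    exact isAlgebraic_of_ringHom (B := M⟮G⟯) (IntermediateField.inclusion hle).toRingHom
      fun _ => rfl
  have hcz : CharZero M := charZero_of_injective_algebraMap (algebraMap k M).injective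
  let e := RatFunc.algEquivOfTranscendental G hGM
  let _ : Algebra M[X] E := (aeval G).toAlgebra
  let _ : Algebra (RatFunc M) E := ((M⟮G⟯).val.comp e.toAlgHom).toAlgebra
  have i1 : IsScalarTower M M[X] E := .of_algebraMap_eq fun x => by
    change _ = aeval G (C x)
    simp
  have i2 : IsScalarTower M[X] (RatFunc M) E := .of_algebraMap_eq fun x => by
    change aeval G x = ((e (algebraMap M[X] (RatFunc M) x) : M⟮G⟯) : E)
    simp [e]
  have i3 : IsScalarTower M (RatFunc M) E := .of_algebraMap_eq fun x => by
    change _ = ((e (algebraMap M (RatFunc M) x) : M⟮G⟯) : E)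
    rw [e.commutes]; rfl
  have i4 : IsScalarTower k (RatFunc M) E := .of_algebraMap_eq fun x => by
    rw [IsScalarTower.algebraMap_apply k M E, IsScalarTower.algebraMap_apply M (RatFunc M) E]
    rfl
  have halg' : Algebra.IsAlgebraic (RatFunc M) E := by
    refine isAlgebraic_of_ringHom (A := M⟮G⟯) e.symm.toAlgHom.toRingHom fun y => ?_
    change ((e (e.symm y) : M⟮G⟯) : E) = _
    rw [e.apply_symm_apply]; rfl
  have hcz' : CharZero (RatFunc M) :=
    charZero_of_injective_algebraMap (algebraMap M (RatFunc M)).injective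
  have i5 : Algebra.EssFiniteType (RatFunc M) E := Algebra.EssFiniteType.of_comp k _ _
  have i6 : Algebra.FormallyUnramified (RatFunc M) E :=
    Algebra.FormallyUnramified.of_isSeparable _ _
  have i7 : FiniteDimensional (RatFunc M) E := Algebra.FormallyUnramified.finite_of_free _ _
  obtain ⟨D, hD⟩ := exists_derivation_sum_logDeriv_ne_one M E
  refine ⟨D.restrictScalars k, fun {ι} s c u hu h => hD s (fun i => algebraMap k M (c i)) u hu ?_⟩
  have : algebraMap M[X] E X = G := aeval_X G
  rw [this]
  simpa [algebraMap_smul] using h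

lemma logDeriv_identity {K : Type*} [Field K] {m b c f d e b' c' f' d' e' : K} (hc : c ≠ 0)
    (hf : f ≠ 0) (hd : d ≠ 0) (he : e ≠ 0)
    (h : (b' * c - b * c') * (f * d * e) =
      c ^ 2 * (m * f' * d * e + d' * f * e - e' * f * d)) :
    m * (f' / f) + 1 * (d' / d) + -1 * (e' / e) = c⁻¹ ^ 2 * (c * b' - b * c') := by
  field_simp
  linear_combination -h

lemma exists_derivation_of_isFractionRing {k R E : Type*} [Field k] [CommRing R] [IsDomain R]
    [Algebra k R] [Algebra.FiniteType k R] [Field E] [Algebra R E] [IsFractionRing R E]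
    [Algebra k E] [IsScalarTower k R E] (D : Derivation k E E) :
    ∃ (r : R) (δ : Derivation k R R), r ≠ 0 ∧
      ∀ x, algebraMap R E (δ x) = algebraMap R E r * D (algebraMap R E x) := by
  obtain ⟨S, hS⟩ := (inferInstance : Algebra.FiniteType k R).out
  obtain ⟨r, hr⟩ := IsLocalization.exist_integer_multiples (nonZeroDivisors R) S
      (fun i => D (algebraMap R E i))
  have key : ∀ x : R, ∃ y : R, algebraMap R E y = algebraMap R E r * D (algebraMap R E x) := by
    intro x
    have hx : x ∈ Algebra.adjoin k (S : Set R) := hS ▸ trivial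
    induction hx using Algebra.adjoin_induction with
    | mem x hx =>
      obtain ⟨y, hy⟩ := hr x hx
      refine ⟨y, ?_⟩
      rw [hy]
      exact Algebra.smul_def _ _
    | algebraMap c =>
      refine ⟨0, ?_⟩
      rw [← IsScalarTower.algebraMap_apply, Derivation.map_algebraMap]
      simp
    | add x y _ _ hx hy =>
      obtain ⟨x', hx⟩ := hx
      obtain ⟨y', hy⟩ := hy
      exact ⟨x' + y', by rw [map_add, hx, hy, map_add, map_add, mul_add]⟩
    | mul x y _ _ hx hy =>
      obtain ⟨x', hx⟩ := hx
      obtain ⟨y', hy⟩ := hy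
      refine ⟨x * y' + y * x', ?_⟩
      rw [map_add, map_mul, map_mul, hx, hy, map_mul, Derivation.leibniz, smul_eq_mul, smul_eq_mul]
      ring
  choose f hf using key
  have hinj : Function.Injective (algebraMap R E) := IsFractionRing.injective R E
  refine ⟨r, Derivation.mk' ⟨⟨f, ?_⟩, ?_⟩ ?_, nonZeroDivisors.coe_ne_zero r, hf⟩
  · intro x y
    apply hinj
    rw [map_add, hf, hf, hf, map_add, map_add, mul_add]
  · intro c x
    apply hinj
    simp only [Algebra.smul_def, map_mul, RingHom.id_apply]
    rw [hf, hf, map_mul, ← IsScalarTower.algebraMap_apply, Derivation.leibniz,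
      Derivation.map_algebraMap, smul_zero, add_zero, smul_eq_mul]
    ring
  · intro x y
    apply hinj
    simp only [smul_eq_mul, LinearMap.coe_mk, AddHom.coe_mk]
    rw [hf, map_add, map_mul (algebraMap R E), map_mul (algebraMap R E), map_mul (algebraMap R E),
      hf, hf, Derivation.leibniz, smul_eq_mul, smul_eq_mul]
    ring

/-- The algebraic core: over an algebraically closed field, `e^{b/c} = f^μ · d/e` forces `b/c` to
be constant. The exponential relation is tested against a single derivation. -/
lemma exists_eq_smul_or_exists_derivation {k R : Type*} [Field k] [CharZero k] [IsAlgClosed k]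
    [CommRing R] [IsDomain R] [Algebra k R] [Algebra.FiniteType k R] (b c : R) (hc : c ≠ 0) :
    (∃ κ : k, b = κ • c) ∨ ∃ δ : Derivation k R R, ∀ (μ : k) (f d e : R),
      f ≠ 0 → d ≠ 0 → e ≠ 0 → (δ b * c - b * δ c) * (f * d * e) ≠
        c ^ 2 * (algebraMap k R μ * δ f * d * e + δ d * f * e - δ e * f * d) := by
  let E := FractionRing R
  let φ : R →+* E := algebraMap R E
  have hφ : Function.Injective φ := IsFractionRing.injective R E
  have hφne : ∀ x, x ≠ 0 → φ x ≠ 0 := fun x hx => (map_ne_zero_iff φ hφ).2 hx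
  have : Algebra.EssFiniteType R E := Algebra.EssFiniteType.of_isLocalization E (nonZeroDivisors R)
  have : Algebra.EssFiniteType k E := Algebra.EssFiniteType.comp k R E
  by_cases hG : Transcendental k (φ b / φ c)
  · right
    obtain ⟨D, hD⟩ := exists_derivation_sum_logDeriv_ne hG
    obtain ⟨r, δ, hr, hδ⟩ := exists_derivation_of_isFractionRing (R := R) D
    refine ⟨δ, fun μ f d e hf hd he h => ?_⟩
    have hr' := hφne r hr
    have hf' := hφne f hf
    have hd' := hφne d hd
    have he' := hφne e he
    have hc' := hφne c hc
    refine hD (Finset.univ : Finset (Fin 3)) ![μ, 1, -1] ![φ f, φ d, φ e] ?_ ?_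
    · intro i _
      fin_cases i
      exacts [hf', hd', he']
    · have h2 := congrArg φ h
      change ∀ x, φ (δ x) = φ r * D (φ x) at hδ
      simp only [map_mul, map_sub, map_add, map_pow, hδ] at h2
      have hμ : φ (algebraMap k R μ) = algebraMap k E μ :=
        (IsScalarTower.algebraMap_apply k R E μ).symm
      rw [hμ] at h2
      simp only [Fin.sum_univ_three, Matrix.cons_val, Derivation.leibniz_div, Algebra.smul_def,
        map_one, map_neg]
      simp only [Algebra.algebraMap_self, RingHom.id_apply]
      refine logDeriv_identity hc' hf' hd' he' (mul_left_cancel₀ hr' ?_)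
      linear_combination h2
  · left
    obtain ⟨κ, hκ⟩ : ∃ κ : k, algebraMap k E κ = φ b / φ c := by
      have hi : IsIntegral k (φ b / φ c) := by
        rw [Transcendental, not_not] at hG
        exact hG.isIntegral
      exact minpoly.mem_range_of_degree_eq_one k _
        (IsAlgClosed.degree_eq_one_of_irreducible k (minpoly.irreducible hi))
    refine ⟨κ, hφ ?_⟩
    rw [Algebra.smul_def, map_mul, ← div_eq_iff (hφne c hc), ← hκ]
    exact IsScalarTower.algebraMap_apply k R E κ

end

/-- The linearised derivative of the relation `b/c = m log f + log (d/e)` integrates: here `B`, …,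
`E` are infinitesimal variations of `b`, …, `e`. -/
lemma variation_eq_zero {V : Set ℂ} (hV : IsOpen V) (hVc : IsPreconnected V) (hV0 : 0 ∈ V) (m : ℂ)
    {b c f d e B C F D E b' c' f' d' e' B' C' F' D' E' : ℂ → ℂ}
    (hb : ∀ s ∈ V, HasDerivAt b (b' s) s) (hc : ∀ s ∈ V, HasDerivAt c (c' s) s)
    (hf : ∀ s ∈ V, HasDerivAt f (f' s) s) (hd : ∀ s ∈ V, HasDerivAt d (d' s) s)
    (he : ∀ s ∈ V, HasDerivAt e (e' s) s)
    (hB : ∀ s ∈ V, HasDerivAt B (B' s) s) (hC : ∀ s ∈ V, HasDerivAt C (C' s) s)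
    (hF : ∀ s ∈ V, HasDerivAt F (F' s) s) (hD : ∀ s ∈ V, HasDerivAt D (D' s) s)
    (hE : ∀ s ∈ V, HasDerivAt E (E' s) s)
    (hB0 : B 0 = 0) (hC0 : C 0 = 0) (hF0 : F 0 = 0) (hD0 : D 0 = 0) (hE0 : E 0 = 0)
    (hcn : ∀ s ∈ V, c s ≠ 0) (hfn : ∀ s ∈ V, f s ≠ 0) (hdn : ∀ s ∈ V, d s ≠ 0)
    (hen : ∀ s ∈ V, e s ≠ 0)
    (h : ∀ s ∈ V, (b' s * c s - b s * c' s) * (f s * d s * e s) =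
      c s ^ 2 * (m * f' s * d s * e s + d' s * f s * e s - e' s * f s * d s))
    (h' : ∀ s ∈ V, (B' s * c s + b' s * C s - (B s * c' s + b s * C' s)) * (f s * d s * e s) +
        (b' s * c s - b s * c' s) * (F s * d s * e s + f s * D s * e s + f s * d s * E s) =
      2 * c s * C s * (m * f' s * d s * e s + d' s * f s * e s - e' s * f s * d s) +
      c s ^ 2 * ((m * F' s * d s * e s + D' s * f s * e s - E' s * f s * d s) +
        (m * f' s * D s * e s + d' s * F s * e s - e' s * F s * d s) +
        (m * f' s * d s * E s + d' s * f s * E s - e' s * f s * D s)))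
    {s : ℂ} (hs : s ∈ V) :
    (B s * c s - b s * C s) * (f s * d s * e s) =
      c s ^ 2 * (m * F s * d s * e s + D s * f s * e s - E s * f s * d s) := by
  let T : ℂ → ℂ := fun s =>
    B s / c s - b s * C s / c s ^ 2 - m * (F s / f s) - D s / d s + E s / e s
  have hT : ∀ s ∈ V, HasDerivAt T 0 s := by
    intro s hs
    have hc0 := hcn s hs
    have hf0 := hfn s hs
    have hd0 := hdn s hs
    have he0 := hen s hs
    have := (((((hB s hs).div (hc s hs) hc0).sub
      (((hb s hs).mul (hC s hs)).div ((hc s hs).pow 2) (pow_ne_zero 2 hc0))).sub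
      (((hF s hs).div (hf s hs) hf0).const_mul m)).sub ((hD s hs).div (hd s hs) hd0)).add
      ((hE s hs).div (he s hs) he0)
    refine this.congr_deriv ?_
    have h1 := h s hs
    have h2 := h' s hs
    apply mul_left_cancel₀ (show (c s ^ 2 * (f s * d s * e s)) ^ 2 ≠ 0 by positivity)
    simp only [Nat.cast_ofNat, Nat.add_one_sub_one, pow_one, Pi.pow_apply, Pi.mul_apply]
    linear_combination (norm := (field_simp; ring)) (c s ^ 2 * (f s * d s * e s)) * h2 -
      (2 * c s * C s * (f s * d s * e s) +
        c s ^ 2 * (F s * d s * e s + f s * D s * e s + f s * d s * E s)) * h1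
  have hT0 : T s = T 0 :=
    hV.is_const_of_deriv_eq_zero hVc
      (fun z hz => (hT z hz).differentiableAt.differentiableWithinAt)
      (fun z hz => (hT z hz).deriv) hs hV0
  have h0 : T s = 0 := by
    rw [hT0]; simp [T, hB0, hC0, hF0, hD0, hE0]
  have hc0 := hcn s hs
  have hf0 := hfn s hs
  have hd0 := hdn s hs
  have he0 := hen s hs
  simp only [T] at h0
  field_simp at h0
  linear_combination h0

/-- If `e^{B/C} = F^μ · D/E` in differentiated form, with all five functions affine in functions
`x i` that vanish at `o`, then `B/C` is constant; the functions are indexed in this order. -/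
lemma mul_eq_mul_of_logDeriv_eq {T ι : Type} [Fintype ι] (x : ι → T → ℂ) (o : T)
    (hx0 : ∀ i, x i o = 0) (R : Subalgebra ℂ (T → ℂ)) [IsDomain R] (hR : R.FG)
    (hxR : ∀ i, x i ∈ R) {V : Set ℂ} (hV : IsOpen V) (hVc : IsPreconnected V) (hV0 : 0 ∈ V)
    (μ : ℂ) (a : Fin 5 → ℂ) (y : Fin 5 → ι → ℂ → ℂ)
    (hy : ∀ k i, DifferentiableOn ℂ (y k i) V) (hy0 : ∀ k i, y k i 0 = 0)
    (P Q : Fin 5 → T → ℂ → ℂ) (hP : ∀ k t s, P k t s = a k + ∑ i, y k i s * x i t)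
    (hQ : ∀ k t s, Q k t s = ∑ i, deriv (y k i) s * x i t)
    (hne : ∀ k, k ≠ 0 → ∀ t, ∀ s ∈ V, P k t s ≠ 0)
    (h : ∀ t, ∀ s ∈ V,
      (Q 0 t s * P 1 t s - P 0 t s * Q 1 t s) * (P 2 t s * P 3 t s * P 4 t s) =
        P 1 t s ^ 2 * (μ * Q 2 t s * P 3 t s * P 4 t s + Q 3 t s * P 2 t s * P 4 t s
          - Q 4 t s * P 2 t s * P 3 t s)) (t : T) {s : ℂ} (hs : s ∈ V) :
    P 0 t s * a 1 = a 0 * P 1 t s := by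
  let X : ι → R := fun i => ⟨x i, hxR i⟩
  let p : Fin 5 → ℂ → R := fun k s => algebraMap ℂ R (a k) + ∑ i, y k i s • X i
  let q : Fin 5 → ℂ → R := fun k s => ∑ i, deriv (y k i) s • X i
  have hp : ∀ k s t, (p k s : T → ℂ) t = P k t s := by
    intro k s t
    simp [p, X, hP]
  have hq : ∀ k s t, (q k s : T → ℂ) t = Q k t s := by
    intro k s t
    simp [q, X, hQ]
  have hpne : ∀ k, k ≠ 0 → ∀ s ∈ V, p k s ≠ 0 := by
    intro k hk s hs h0
    apply hne k hk o s hs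
    rw [← hp, h0]; rfl
  have hpq : ∀ s ∈ V, (q 0 s * p 1 s - p 0 s * q 1 s) * (p 2 s * p 3 s * p 4 s) =
        p 1 s ^ 2 * (algebraMap ℂ R μ * q 2 s * p 3 s * p 4 s + q 3 s * p 2 s * p 4 s
          - q 4 s * p 2 s * p 3 s) := by
    intro s hs
    apply Subtype.ext
    funext t
    have := h t s hs
    simp only [← hp, ← hq] at this
    simpa using this
  have : Algebra.FiniteType ℂ R := (Subalgebra.fg_iff_finiteType R).1 hR
  obtain ⟨κ, hκ⟩ | ⟨δ, hδ⟩ :=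
    exists_eq_smul_or_exists_derivation (k := ℂ) (p 0 s) (p 1 s) (hpne 1 (by decide) s hs)
  · have hκ' : ∀ t, P 0 t s = κ * P 1 t s := by
      intro t
      rw [← hp, ← hp, hκ]
      rfl
    have h0 := hκ' o
    simp only [hP, hx0, mul_zero, Finset.sum_const_zero, add_zero] at h0
    rw [hκ', h0]
    ring
  · exfalso
    refine hδ μ (p 2 s) (p 3 s) (p 4 s) (hpne 2 (by decide) s hs) (hpne 3 (by decide) s hs)
      (hpne 4 (by decide) s hs) ?_
    apply Subtype.ext
    funext t
    have hδp : ∀ k s, (δ (p k s) : T → ℂ) t = ∑ i, y k i s * (δ (X i) : T → ℂ) t := by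
      intro k s
      simp [p]
    have hδq : ∀ k s, (δ (q k s) : T → ℂ) t = ∑ i, deriv (y k i) s * (δ (X i) : T → ℂ) t := by
      intro k s
      simp [q]
    have hyd : ∀ k i, ∀ s ∈ V, HasDerivAt (y k i) (deriv (y k i) s) s := fun k i s hs =>
      ((hy k i).differentiableAt (hV.mem_nhds hs)).hasDerivAt
    have dp : ∀ k, ∀ s ∈ V, HasDerivAt (fun s => (p k s : T → ℂ) t) ((q k s : T → ℂ) t) s := by
      intro k s hs
      simp only [hp, hq, hP, hQ]
      exact (HasDerivAt.fun_sum fun i _ => (hyd k i s hs).mul_const _).const_add _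
    have dδ : ∀ k, ∀ s ∈ V,
        HasDerivAt (fun s => (δ (p k s) : T → ℂ) t) ((δ (q k s) : T → ℂ) t) s := by
      intro k s hs
      simp only [hδp, hδq]
      exact HasDerivAt.fun_sum fun i _ => (hyd k i s hs).mul_const _
    have h0 : ∀ k, (δ (p k 0) : T → ℂ) t = 0 := by
      intro k
      simp [hδp, hy0]
    have n0 : ∀ k, k ≠ 0 → ∀ s ∈ V, (p k s : T → ℂ) t ≠ 0 := by
      intro k hk s hs
      rw [hp]
      exact hne k hk t s hs
    have key := variation_eq_zero hV hVc hV0 μ (dp 0) (dp 1) (dp 2) (dp 3) (dp 4) (dδ 0) (dδ 1)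
      (dδ 2) (dδ 3) (dδ 4) (h0 0) (h0 1) (h0 2) (h0 3) (h0 4) (n0 1 (by decide))
      (n0 2 (by decide)) (n0 3 (by decide)) (n0 4 (by decide)) ?_ ?_ hs
    · simpa using key
    · intro s hs
      have := congrFun (congrArg Subtype.val (hpq s hs)) t
      simpa using this
    · intro s hs
      have := congrFun (congrArg Subtype.val (congrArg δ (hpq s hs))) t
      simp [Derivation.leibniz, Derivation.leibniz_pow] at this
      have h2 : ((2 : R) : T → ℂ) t = 2 := rfl
      rw [h2] at this
      linear_combination this

lemma isDomain_of_analyticOnNhd {U : Set ℂ} (hU : IsPreconnected U) (hne : U.Nonempty)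
    (R : Subalgebra ℂ (U → ℂ))
    (hR : ∀ f ∈ R, ∃ g : ℂ → ℂ, AnalyticOnNhd ℂ g U ∧ ∀ t : U, f t = g t) : IsDomain R := by
  have : Nonempty U := hne.to_subtype
  have : NoZeroDivisors R := by
    refine ⟨fun {f g} hfg => ?_⟩
    obtain ⟨f', hf, hff⟩ := hR f f.2
    obtain ⟨g', hg, hgg⟩ := hR g g.2
    have hmul : ∀ z ∈ U, f' z * g' z = 0 := by
      intro z hz
      have := congrFun (congrArg Subtype.val hfg) ⟨z, hz⟩
      simpa [hff, hgg] using this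
    refine (hf.eq_zero_or_eq_zero_of_mul_eq_zero hg hmul hU).imp (fun h => ?_) (fun h => ?_)
    · apply Subtype.ext
      funext t
      rw [hff]
      exact h t t.2
    · apply Subtype.ext
      funext t
      rw [hgg]
      exact h t t.2
  exact NoZeroDivisors.to_isDomain R

lemma exists_analyticOnNhd_of_mem_adjoin {U : Set ℂ} {ι : Type*} (x : ι → ℂ → ℂ)
    (hx : ∀ i, AnalyticOnNhd ℂ (x i) U) (f : U → ℂ)
    (hf : f ∈ Algebra.adjoin ℂ (Set.range fun i => U.domRestrict (x i))) :
    ∃ g : ℂ → ℂ, AnalyticOnNhd ℂ g U ∧ ∀ t : U, f t = g t := by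
  induction hf using Algebra.adjoin_induction with
  | mem f hf =>
    obtain ⟨i, rfl⟩ := hf
    exact ⟨x i, hx i, fun t => rfl⟩
  | algebraMap c => exact ⟨fun _ => c, analyticOnNhd_const, fun t => rfl⟩
  | add f g _ _ hf hg =>
    obtain ⟨f', hf, hff⟩ := hf
    obtain ⟨g', hg, hgg⟩ := hg
    exact ⟨f' + g', hf.add hg, fun t => by simp [hff, hgg]⟩
  | mul f g _ _ hf hg =>
    obtain ⟨f', hf, hff⟩ := hf
    obtain ⟨g', hg, hgg⟩ := hg
    exact ⟨f' * g', hf.mul hg, fun t => by simp [hff, hgg]⟩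

lemma eq_zero_of_eq_zero_on_real {r : ℝ} {f : ℂ → ℂ}
    (hf : DifferentiableOn ℂ f (Metric.ball 0 r))
    (h : ∀ x : ℝ, |x| < r → f x = 0) {z : ℂ} (hz : ‖z‖ < r) : f z = 0 := by
  have hr : 0 < r := (norm_nonneg z).trans_lt hz
  have hz' : z ∈ Metric.ball (0 : ℂ) r := by simpa using hz
  refine (hf.analyticOnNhd Metric.isOpen_ball).eqOn_zero_of_preconnected_of_frequently_eq_zero
    (convex_ball _ _).isPreconnected (Metric.mem_ball_self hr) ?_ hz'
  have h1 : Tendsto (fun x : ℝ => (x : ℂ)) (𝓝[≠] 0) (𝓝[≠] 0) := by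
    refine tendsto_nhdsWithin_iff.2 ⟨?_, ?_⟩
    · have : Tendsto (fun x : ℝ => (x : ℂ)) (𝓝 0) (𝓝 ((0 : ℝ) : ℂ)) :=
        Complex.continuous_ofReal.tendsto 0
      exact (this.mono_left nhdsWithin_le_nhds)
    · filter_upwards [self_mem_nhdsWithin] with x hx
      simpa using hx
  refine h1.frequently (Eventually.frequently ?_)
  have : ∀ᶠ x : ℝ in 𝓝 0, |x| < r := by
    filter_upwards [Metric.ball_mem_nhds (0 : ℝ) hr] with x hx
    simpa using hx
  exact (this.filter_mono nhdsWithin_le_nhds).mono h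

/-- Polarisation: a holomorphic function of two variables vanishing on `s = conj t` vanishes. -/
lemma eq_zero_of_eq_zero_on_conj {ρ : ℝ} {Φ : ℂ → ℂ → ℂ}
    (hΦ : ∀ (T S : ℂ → ℂ) (w : ℂ), DifferentiableAt ℂ T w → DifferentiableAt ℂ S w →
      ‖T w‖ < ρ → ‖S w‖ < ρ → DifferentiableAt ℂ (fun w => Φ (T w) (S w)) w)
    (h : ∀ t, ‖t‖ < ρ → Φ t (starRingEnd ℂ t) = 0) {t s : ℂ} (ht : ‖t‖ < ρ / 2)
    (hs : ‖s‖ < ρ / 2) : Φ t s = 0 := by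
  have hlt : ∀ {u v : ℂ}, ‖u‖ < ρ / 2 → ‖v‖ < ρ / 2 → ‖u + v * I‖ < ρ ∧ ‖u - v * I‖ < ρ := by
    intro u v hu hv
    have h1 := norm_add_le u (v * I)
    have h2 := norm_sub_le u (v * I)
    rw [norm_mul, norm_I, mul_one] at h1 h2
    constructor <;> linarith
  have key1 : ∀ v : ℝ, |v| < ρ / 2 → ∀ u : ℂ, ‖u‖ < ρ / 2 → Φ (u + v * I) (u - v * I) = 0 := by
    intro v hv u hu
    have hv' : ‖(v : ℂ)‖ < ρ / 2 := by simpa using hv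
    refine eq_zero_of_eq_zero_on_real (r := ρ / 2) (f := fun u => Φ (u + v * I) (u - v * I))
      ?_ ?_ hu
    · intro w hw
      rw [mem_ball_zero_iff] at hw
      exact (hΦ (fun u => u + v * I) (fun u => u - v * I) w (by fun_prop) (by fun_prop)
        (hlt hw hv').1 (hlt hw hv').2).differentiableWithinAt
    · intro x hx
      have := h (x + v * I) (hlt (by simpa using hx) hv').1
      simpa [sub_eq_add_neg] using this
  have key2 : ∀ u v : ℂ, ‖u‖ < ρ / 2 → ‖v‖ < ρ / 2 → Φ (u + v * I) (u - v * I) = 0 := by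
    intro u v hu hv
    refine eq_zero_of_eq_zero_on_real (r := ρ / 2) (f := fun v => Φ (u + v * I) (u - v * I))
      ?_ (fun x hx => key1 x hx u hu) hv
    intro w hw
    rw [mem_ball_zero_iff] at hw
    exact (hΦ (fun v => u + v * I) (fun v => u - v * I) w (by fun_prop) (by fun_prop)
      (hlt hu hw).1 (hlt hu hw).2).differentiableWithinAt
  have h1 := norm_add_le t s
  have h2 := norm_sub_le t s
  have := key2 ((t + s) / 2) ((t - s) / 2 * (-I)) ?_ ?_
  · have e1 : (t + s) / 2 + (t - s) / 2 * -I * I = t := by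
      linear_combination -((t - s) / 2) * I_sq
    have e2 : (t + s) / 2 - (t - s) / 2 * -I * I = s := by
      linear_combination ((t - s) / 2) * I_sq
    rwa [e1, e2] at this
  · rw [norm_div]; simp; linarith
  · rw [norm_mul, norm_div]; simp; linarith

lemma mul_eq_mul_of_eq_log_add_log {ι : Type} [Fintype ι] {ρ : ℝ} (μ : ℂ)
    (x : ι → ℂ → ℂ) (a : Fin 5 → ℂ) (y : Fin 5 → ι → ℂ → ℂ)
    (hx : ∀ i, DifferentiableOn ℂ (x i) (Metric.ball 0 ρ)) (hx0 : ∀ i, x i 0 = 0)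
    (hy : ∀ k i, DifferentiableOn ℂ (y k i) (Metric.ball 0 ρ)) (hy0 : ∀ k i, y k i 0 = 0)
    (P : Fin 5 → ℂ → ℂ → ℂ) (hP : ∀ k t s, P k t s = a k + ∑ i, y k i s * x i t)
    (h1 : ∀ t s, ‖t‖ < ρ → ‖s‖ < ρ → P 1 t s ≠ 0)
    (h2 : ∀ t s, ‖t‖ < ρ → ‖s‖ < ρ → P 2 t s ∈ slitPlane)
    (h3 : ∀ t s, ‖t‖ < ρ → ‖s‖ < ρ → P 3 t s ≠ 0)
    (h4 : ∀ t s, ‖t‖ < ρ → ‖s‖ < ρ → P 4 t s ≠ 0)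
    (h34 : ∀ t s, ‖t‖ < ρ → ‖s‖ < ρ → P 3 t s / P 4 t s ∈ slitPlane)
    (h : ∀ t, ‖t‖ < ρ → P 0 t (starRingEnd ℂ t) / P 1 t (starRingEnd ℂ t) =
      μ * log (P 2 t (starRingEnd ℂ t)) +
        log (P 3 t (starRingEnd ℂ t) / P 4 t (starRingEnd ℂ t)))
    {t s : ℂ} (ht : ‖t‖ < ρ / 2) (hs : ‖s‖ < ρ / 2) : P 0 t s * a 1 = a 0 * P 1 t s := by
  have hρ : 0 < ρ / 2 := (norm_nonneg t).trans_lt ht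
  have hρ' : ∀ {t : ℂ}, ‖t‖ < ρ / 2 → ‖t‖ < ρ := fun h => by linarith
  have hsub : Metric.ball (0 : ℂ) (ρ / 2) ⊆ Metric.ball 0 ρ :=
    Metric.ball_subset_ball (by linarith)
  have dP : ∀ k (T S : ℂ → ℂ) (w : ℂ), DifferentiableAt ℂ T w → DifferentiableAt ℂ S w →
      ‖T w‖ < ρ → ‖S w‖ < ρ → DifferentiableAt ℂ (fun w => P k (T w) (S w)) w := by
    intro k T S w hT hS hTw hSw
    simp only [hP]
    refine (DifferentiableAt.fun_sum fun i _ => ?_).const_add _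
    have hx' : DifferentiableAt ℂ (x i) (T w) :=
      (hx i).differentiableAt (Metric.isOpen_ball.mem_nhds (by simpa using hTw))
    have hy' : DifferentiableAt ℂ (y k i) (S w) :=
      (hy k i).differentiableAt (Metric.isOpen_ball.mem_nhds (by simpa using hSw))
    exact (hy'.comp w hS).mul (hx'.comp w hT)
  have hΦ : ∀ t s, ‖t‖ < ρ / 2 → ‖s‖ < ρ / 2 →
      P 0 t s / P 1 t s - (μ * log (P 2 t s) + log (P 3 t s / P 4 t s)) = 0 := by
    intro t s ht hs
    refine eq_zero_of_eq_zero_on_conj (ρ := ρ) (Φ := fun t s =>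
      P 0 t s / P 1 t s - (μ * log (P 2 t s) + log (P 3 t s / P 4 t s))) ?_ ?_ ht hs
    · intro T S w hT hS hTw hSw
      have d := fun k => dP k T S w hT hS hTw hSw
      exact ((d 0).div (d 1) (h1 _ _ hTw hSw)).sub
        ((((d 2).clog (h2 _ _ hTw hSw)).const_mul μ).add
          (((d 3).div (d 4) (h4 _ _ hTw hSw)).clog (h34 _ _ hTw hSw)))
    · intro t ht
      rw [h t ht, sub_self]
  let Q : Fin 5 → ℂ → ℂ → ℂ := fun k t s => ∑ i, deriv (y k i) s * x i t
  have hPQ : ∀ k t s, ‖s‖ < ρ → HasDerivAt (fun s => P k t s) (Q k t s) s := by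
    intro k t s hs
    simp only [hP]
    exact (HasDerivAt.fun_sum fun i _ => (((hy k i).differentiableAt
      (Metric.isOpen_ball.mem_nhds (by simpa using hs))).hasDerivAt).mul_const _).const_add _
  let U : Set ℂ := Metric.ball 0 (ρ / 2)
  have hU0 : (0 : ℂ) ∈ U := Metric.mem_ball_self hρ
  have hUc : IsPreconnected U := (convex_ball _ _).isPreconnected
  let X : ι → U → ℂ := fun i => U.domRestrict (x i)
  let R : Subalgebra ℂ (U → ℂ) := Algebra.adjoin ℂ (Set.range X)
  have : IsDomain R := isDomain_of_analyticOnNhd hUc ⟨0, hU0⟩ R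
    (exists_analyticOnNhd_of_mem_adjoin x fun i =>
      ((hx i).mono hsub).analyticOnNhd Metric.isOpen_ball)
  have hR : R.FG := Subalgebra.fg_def.2 ⟨_, Set.finite_range X, rfl⟩
  refine mul_eq_mul_of_logDeriv_eq X (⟨0, hU0⟩ : U) hx0 R hR
    (fun i => Algebra.subset_adjoin ⟨i, rfl⟩) (V := U) Metric.isOpen_ball hUc hU0 μ a y
    (fun k i => (hy k i).mono hsub) hy0 (fun k t s => P k t s) (fun k t s => Q k t s)
    (fun k t s => hP k t s) (fun k t s => rfl) ?_ ?_ ⟨t, by simpa [U] using ht⟩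
    (by simpa [U] using hs)
  · intro k hk t s hs
    have ht' : ‖(t : ℂ)‖ < ρ := by simpa using hsub t.2
    have hs' : ‖s‖ < ρ := by simpa using hsub hs
    fin_cases k
    · exact absurd rfl hk
    · exact h1 _ _ ht' hs'
    · exact slitPlane_ne_zero (h2 _ _ ht' hs')
    · exact h3 _ _ ht' hs'
    · exact h4 _ _ ht' hs'
  · intro t s hs
    have ht' : ‖(t : ℂ)‖ < ρ / 2 := mem_ball_zero_iff.1 t.2
    have hs' : ‖s‖ < ρ / 2 := by simpa [U] using hs
    have n1 := h1 _ _ (hρ' ht') (hρ' hs')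
    have n2 := slitPlane_ne_zero (h2 _ _ (hρ' ht') (hρ' hs'))
    have n3 := h3 _ _ (hρ' ht') (hρ' hs')
    have n4 := h4 _ _ (hρ' ht') (hρ' hs')
    have d := fun k => hPQ k t s (hρ' hs')
    have hd := ((d 0).div (d 1) n1).sub ((((d 2).clog (h2 _ _ (hρ' ht') (hρ' hs'))).const_mul μ).add
          (((d 3).div (d 4) n4).clog (h34 _ _ (hρ' ht') (hρ' hs'))))
    have hz := hd.unique ((hasDerivAt_const s (0 : ℂ)).congr_of_eventuallyEq ?_)
    · simp only [Pi.div_apply] at hz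
      field_simp at hz
      linear_combination hz
    · filter_upwards [Metric.isOpen_ball.mem_nhds hs] with w hw
      exact hΦ t w ht' (by simpa using hw)

lemma re_div_pos_of_norm_sub_one_lt {u v : ℂ} (hu : ‖u - 1‖ < 1 / 4) (hv : ‖v - 1‖ < 1 / 4) :
    0 < (u / v).re := by
  have u1 := (abs_lt.1 ((abs_re_le_norm (u - 1)).trans_lt hu)).1
  have u2 := abs_lt.1 ((abs_im_le_norm (u - 1)).trans_lt hu)
  have v1 := (abs_lt.1 ((abs_re_le_norm (v - 1)).trans_lt hv)).1
  have v2 := abs_lt.1 ((abs_im_le_norm (v - 1)).trans_lt hv)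
  simp only [sub_re, sub_im, one_re, one_im, sub_zero] at u1 u2 v1 v2
  have hv0 : 0 < normSq v := normSq_pos.2 (by rintro rfl; simp at v1; linarith)
  rw [div_re, ← add_div]
  apply div_pos _ hv0
  nlinarith [mul_pos (by linarith : 0 < u.re - 3 / 4) (by linarith : 0 < v.re - 3 / 4),
    mul_pos (by linarith [u2.1] : 0 < 1 / 4 + u.im) (by linarith [v2.1] : 0 < 1 / 4 + v.im),
    mul_pos (by linarith [u2.2] : 0 < 1 / 4 - u.im) (by linarith [v2.2] : 0 < 1 / 4 - v.im)]

lemma eventually_div_eq_of_exp_eq {n : ℕ} (p : Fin n → ℂ) (μ : ℝ) (m l : Fin 5 → ℕ)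
    (A : ∀ k, Fin (m k) → (Fin n → ℂ) → ℂ) (hA : ∀ k j, AnalyticAt ℂ (A k j) p)
    (hA0 : ∀ k j, A k j p = 0) (a : Fin 5 → ℝ) (h1 : a 1 ≠ 0) (h4 : a 4 ≠ 0)
    (H : Fin 5 → (Fin n → ℂ) → ℝ) (hH : ∀ k z, H k z = a k + hermR (l k) (A k) z)
    (hpos : ∀ᶠ z in 𝓝 p, 0 < H 2 z)
    (heq : ∀ᶠ z in 𝓝 p, Real.exp (H 0 z / H 1 z) = H 2 z ^ μ * (H 3 z / H 4 z)) :
    ∀ᶠ z in 𝓝 p, H 0 z / H 1 z = a 0 / a 1 := by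
  have hHp : ∀ k, H k p = a k := by
    intro k
    simp [hH, hermR, hA0]
  have ha2 : 0 < a 2 := hHp 2 ▸ hpos.self_of_nhds
  have quot_pos : ∀ z, 0 < H 2 z →
      Real.exp (H 0 z / H 1 z) = H 2 z ^ μ * (H 3 z / H 4 z) → 0 < H 3 z / H 4 z := by
    intro z hz he
    exact pos_of_mul_pos_right (he ▸ Real.exp_pos _) (Real.rpow_pos_of_pos hz μ).le
  have ha34 : 0 < a 3 / a 4 := by
    have := quot_pos p hpos.self_of_nhds heq.self_of_nhds
    rwa [hHp, hHp] at this
  have ha : ∀ k, k ≠ 0 → a k ≠ 0 := by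
    intro k hk
    fin_cases k
    · exact absurd rfl hk
    · exact h1
    · exact ha2.ne'
    · intro h
      simp only [Fin.reduceFinMk] at h
      simp [h] at ha34
    · exact h4
  have hsmall : ∀ k, k ≠ 0 → ∀ᶠ z in 𝓝 p, ∑ j, ‖A k j z‖ ^ 2 < |a k| / 4 := by
    intro k hk
    have hc : ContinuousAt (fun z => ∑ j, ‖A k j z‖ ^ 2) p :=
      tendsto_finsetSum _ fun j _ => ((hA k j).continuousAt.norm.pow 2)
    refine hc.eventually_lt continuousAt_const ?_
    simpa [hA0] using ha k hk
  have hall : ∀ᶠ z in 𝓝 p, (∀ k j, DifferentiableAt ℂ (A k j) z) ∧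
      (∀ k, k ≠ 0 → ∑ j, ‖A k j z‖ ^ 2 < |a k| / 4) ∧ 0 < H 2 z ∧
      Real.exp (H 0 z / H 1 z) = H 2 z ^ μ * (H 3 z / H 4 z) := by
    refine .and ?_ (.and ?_ (hpos.and heq))
    · rw [eventually_all]
      intro k
      rw [eventually_all]
      intro j
      exact (hA k j).eventually_analyticAt.mono fun z hz => hz.differentiableAt
    · rw [eventually_all]
      intro k
      rw [eventually_all]
      exact hsmall k
  obtain ⟨r, hr, hball⟩ := Metric.eventually_nhds_iff.1 hall
  refine Metric.eventually_nhds_iff.2 ⟨r / 4, by positivity, fun z hz => ?_⟩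
  let L : ℂ → (Fin n → ℂ) := fun t => p + t • (z - p)
  have hL : ∀ t : ℂ, ‖t‖ < 4 → dist (L t) p < r := by
    intro t ht
    rw [dist_eq_norm] at hz ⊢
    simp only [L, add_sub_cancel_left, norm_smul]
    nlinarith [norm_nonneg t, norm_nonneg (z - p)]
  let σ : ∀ k, Fin (m k) → ℝ := fun k j => if (j : ℕ) < l k then 1 else -1
  have hσ : ∀ k j, ‖(σ k j : ℂ)‖ = 1 := by
    intro k j
    simp only [σ]
    split_ifs <;> simp
  let x : (Σ k, Fin (m k)) → ℂ → ℂ := fun i t => A i.1 i.2 (L t)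
  let y : Fin 5 → (Σ k, Fin (m k)) → ℂ → ℂ := fun k i s =>
    if k = i.1 then σ i.1 i.2 * starRingEnd ℂ (x i (starRingEnd ℂ s)) else 0
  let P : Fin 5 → ℂ → ℂ → ℂ := fun k t s => a k + ∑ i, y k i s * x i t
  have hP : ∀ k t s, P k t s = a k + ∑ j, (σ k j *
      starRingEnd ℂ (A k j (L (starRingEnd ℂ s)))) * A k j (L t) := by
    intro k t s
    simp only [P, y, x, Fintype.sum_sigma, ite_mul, zero_mul]
    congr 1
    rw [Finset.sum_eq_single k]
    · simp
    · intro k' _ hk'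
      simp [hk'.symm]
    · simp
  have hPH : ∀ k t, P k t (starRingEnd ℂ t) = (H k (L t) : ℂ) := by
    intro k t
    rw [hP, hH, hermR]
    push_cast
    congr 1
    refine Finset.sum_congr rfl fun j _ => ?_
    rw [conj_conj, mul_assoc, ← normSq_eq_conj_mul_self]
  have hx : ∀ i, DifferentiableOn ℂ (x i) (Metric.ball 0 4) := by
    intro i t ht
    have := (hball (hL t (mem_ball_zero_iff.1 ht))).1 i.1 i.2
    refine (this.comp t ?_).differentiableWithinAt
    fun_prop
  have hPa : ∀ k, k ≠ 0 → ∀ t s, ‖t‖ < 4 → ‖s‖ < 4 → ‖P k t s / a k - 1‖ < 1 / 4 := by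
    intro k hk t s ht hs
    have hs' : ‖starRingEnd ℂ s‖ < 4 := by simpa using hs
    have e1 := (hball (hL t ht)).2.1 k hk
    have e2 := (hball (hL _ hs')).2.1 k hk
    have hak : (a k : ℂ) ≠ 0 := by exact_mod_cast ha k hk
    rw [div_sub_one hak, hP, add_sub_cancel_left, norm_div, norm_real, Real.norm_eq_abs,
      div_lt_iff₀ (abs_pos.2 (ha k hk))]
    have : ‖∑ j, (σ k j * starRingEnd ℂ (A k j (L (starRingEnd ℂ s)))) * A k j (L t)‖ ≤
        ∑ j, (‖A k j (L t)‖ ^ 2 + ‖A k j (L (starRingEnd ℂ s))‖ ^ 2) / 2 := by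
      refine (norm_sum_le _ _).trans (Finset.sum_le_sum fun j _ => ?_)
      rw [norm_mul, norm_mul, hσ, one_mul, RCLike.norm_conj]
      nlinarith [sq_nonneg (‖A k j (L t)‖ - ‖A k j (L (starRingEnd ℂ s))‖)]
    rw [← Finset.sum_div, Finset.sum_add_distrib] at this
    linarith
  have hPne : ∀ k, k ≠ 0 → ∀ t s, ‖t‖ < 4 → ‖s‖ < 4 → P k t s ≠ 0 := by
    intro k hk t s ht hs h0
    have := hPa k hk t s ht hs
    rw [h0] at this
    norm_num at this
  have key := mul_eq_mul_of_eq_log_add_log (ρ := 4) (μ : ℂ) x (fun k => (a k : ℂ)) y hx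
    (fun i => by simp [x, L, hA0]) ?_ (fun k i => by simp [y, x, L, hA0]) P
    (fun k t s => rfl) (hPne 1 (by decide)) ?_ (hPne 3 (by decide)) (hPne 4 (by decide))
    ?_ ?_ (t := 1) (s := 1) (by norm_num) (by norm_num)
  · have e : ∀ k, P k 1 1 = (H k z : ℂ) := by
      intro k
      have := hPH k 1
      simpa [L] using this
    rw [e, e] at key
    have hH1 : H 1 z ≠ 0 := by
      have := hPne 1 (by decide) 1 1 (by norm_num) (by norm_num)
      rw [e] at this
      exact_mod_cast this
    rw [div_eq_div_iff hH1 h1]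
    exact_mod_cast key
  · intro k i s hs
    have hs' : starRingEnd ℂ s ∈ Metric.ball (0 : ℂ) 4 := by simpa using hs
    have := ((hx i).differentiableAt (Metric.isOpen_ball.mem_nhds hs')).conj_conj
    rw [conj_conj] at this
    simp only [y]
    split_ifs
    · exact (this.const_mul _).differentiableWithinAt
    · exact differentiableWithinAt_const _
  · intro t s ht hs
    have h2 := re_div_pos_of_norm_sub_one_lt (hPa 2 (by decide) t s ht hs) (v := 1) (by simp)
    rw [div_one, div_ofReal_re] at h2
    exact Or.inl ((div_pos_iff_of_pos_right ha2).1 h2)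
  · intro t s ht hs
    have h3 := hPa 3 (by decide) t s ht hs
    have h4 := hPa 4 (by decide) t s ht hs
    have h34 := re_div_pos_of_norm_sub_one_lt h3 h4
    rw [div_div_div_comm, ← ofReal_div, div_ofReal_re] at h34
    exact Or.inl ((div_pos_iff_of_pos_right ha34).1 h34)
  · intro t ht
    obtain ⟨-, -, hp, he⟩ := hball (hL t ht)
    have hq := quot_pos _ hp he
    rw [hPH, hPH, hPH, hPH, hPH]
    have := congrArg Real.log he
    rw [Real.log_exp, Real.log_mul (Real.rpow_pos_of_pos hp μ).ne' hq.ne', Real.log_rpow hp] at this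
    rw [← ofReal_div, ← ofReal_div, ← ofReal_log hp.le, ← ofReal_log hq.le, this]
    push_cast
    rfl

/-- Theorem 2 of the paper: if `g = (b + ⟨β,β⟩_q)/(c + ⟨γ,γ⟩_r) ∈ K̃_p` and
`e^g = f^μ · h` with `f = a + ⟨α,α⟩_ℓ ∈ Λ̃_p` positive and
`h = (d + ⟨δ,δ⟩_u)/(e + ⟨ε,ε⟩_v) ∈ K̃_p`, then `g` is constant near `p`. -/
theorem stmt0 {n : ℕ} (p : Fin n → ℂ) (μ : ℝ)
    {mα mβ mγ mδ mε : ℕ} (ℓ q r u v : ℕ)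
    (hℓ : ℓ ≤ mα) (hq : q ≤ mβ) (hr : r ≤ mγ) (hu : u ≤ mδ) (hv : v ≤ mε)
    (α : Fin mα → (Fin n → ℂ) → ℂ) (β : Fin mβ → (Fin n → ℂ) → ℂ)
    (γ : Fin mγ → (Fin n → ℂ) → ℂ) (δ : Fin mδ → (Fin n → ℂ) → ℂ)
    (ε : Fin mε → (Fin n → ℂ) → ℂ)
    (hαa : ∀ j, AnalyticAt ℂ (α j) p) (hα0 : ∀ j, α j p = 0)
    (hβa : ∀ j, AnalyticAt ℂ (β j) p) (hβ0 : ∀ j, β j p = 0)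
    (hγa : ∀ j, AnalyticAt ℂ (γ j) p) (hγ0 : ∀ j, γ j p = 0)
    (hδa : ∀ j, AnalyticAt ℂ (δ j) p) (hδ0 : ∀ j, δ j p = 0)
    (hεa : ∀ j, AnalyticAt ℂ (ε j) p) (hε0 : ∀ j, ε j p = 0)
    (a b c d e : ℝ)
    (hcne : c + hermR r γ p ≠ 0) (hene : e + hermR v ε p ≠ 0)
    (hfpos : ∀ᶠ z in 𝓝 p, 0 < a + hermR ℓ α z)
    (heq : ∀ᶠ z in 𝓝 p,
      Real.exp ((b + hermR q β z) / (c + hermR r γ z)) =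
        (a + hermR ℓ α z) ^ μ * ((d + hermR u δ z) / (e + hermR v ε z))) :
    ∃ C : ℝ, ∀ᶠ z in 𝓝 p,
      (b + hermR q β z) / (c + hermR r γ z) = C := by
  refine ⟨b / c, ?_⟩
  have hc : c ≠ 0 := by simpa [hermR, hγ0] using hcne
  have he : e ≠ 0 := by simpa [hermR, hε0] using hene
  exact eventually_div_eq_of_exp_eq p μ ![mβ, mγ, mα, mδ, mε] ![q, r, ℓ, u, v]
    (fun k => match k with | 0 => β | 1 => γ | 2 => α | 3 => δ | 4 => ε)
    (fun k => match k with | 0 => hβa | 1 => hγa | 2 => hαa | 3 => hδa | 4 => hεa)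
    (fun k => match k with | 0 => hβ0 | 1 => hγ0 | 2 => hα0 | 3 => hδ0 | 4 => hε0)
    ![b, c, a, d, e] hc he _ (fun _ _ => rfl) hfpos heq
end

section
/- Let V ⊆ ℂ^κ be a connected open set and let H, H₁, …, H_K be holomorphic Nash algebraic functions on V, with each H_k nowhere vanishing on V and H_k(ξ) not a nonpositive real number for all ξ ∈ V. If there exist real numbers μ₁, …, μ_K such that exp(H(ξ)) = ∏_{k=1}^K H_k(ξ)^{μ_k} for all ξ ∈ V, where complex powers are taken with respect to the principal branch of the logarithm, then H is constant on V. -/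
open Filter Topology Complex

/-- A holomorphic function `H` on `V ⊆ ℂ^κ` is Nash algebraic if it satisfies a nontrivial
polynomial equation `P(ξ, H(ξ)) = 0` with polynomial coefficients. -/
def NashAlgebraicOn {κ : ℕ} (H : (Fin κ → ℂ) → ℂ) (V : Set (Fin κ → ℂ)) : Prop :=
  DifferentiableOn ℂ H V ∧
    ∃ P : Polynomial (MvPolynomial (Fin κ) ℂ), P ≠ 0 ∧
      ∀ ξ ∈ V, Polynomial.eval₂ (MvPolynomial.eval ξ) (H ξ) P = 0

open scoped Differential in
open Differential in
theorem Differential.exists_logDeriv_sum_of_isGalois {F K : Type*} [Field F] [Field K]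
    [Differential F] [Differential K] [Algebra F K] [DifferentialAlgebra F K]
    [CharZero F] [FiniteDimensional F K] [IsGalois F K] {ι : Type*} [Fintype ι]
    (a : F) (c : ι → F) (u : ι → K) (hu : ∀ i, u i ≠ 0)
    (h : algebraMap F K a = ∑ i, algebraMap F K (c i) * logDeriv (u i)) :
    ∃ n : ℕ, n ≠ 0 ∧ ∃ v : ι → F, (∀ i, v i ≠ 0) ∧ n * a = ∑ i, c i * logDeriv (v i) := by
  have key (i) : ∃ v : F, algebraMap F K v = ∏ e : K ≃ₐ[F] K, e (u i) := by
    rw [← Set.mem_range, ← IntermediateField.mem_bot, IsGalois.mem_bot_iff_fixed]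
    intro e
    rw [map_prod]
    exact Fintype.prod_equiv (Equiv.mulLeft e) _ _ (by simp)
  choose v hv using key
  have hinj := FaithfulSMul.algebraMap_injective F K
  refine ⟨Fintype.card (K ≃ₐ[F] K), Fintype.card_ne_zero, v, fun i hi => ?_, hinj ?_⟩
  · have := hv i
    rw [hi, map_zero, eq_comm, Finset.prod_eq_zero_iff] at this
    obtain ⟨e, -, he⟩ := this
    exact hu i (by simpa using he)
  · have hlog (i) : logDeriv (∏ e : K ≃ₐ[F] K, e (u i)) = ∑ e : K ≃ₐ[F] K, e (logDeriv (u i)) := by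
      rw [logDeriv_prod _ _ _ fun e _ => by simpa using hu i]
      simp [logDeriv, algEquiv_deriv']
    simp only [map_mul, map_sum, ← logDeriv_algebraMap, hv, hlog, Finset.mul_sum, map_natCast]
    rw [Finset.sum_comm]
    have (e : K ≃ₐ[F] K) :
        ∑ i, algebraMap F K (c i) * e (logDeriv (u i)) = algebraMap F K a := by
      simpa using (congrArg e h).symm
    simp [this]

open scoped Differential in
open Differential in
theorem Differential.exists_logDeriv_sum_of_isAlgebraic {F M : Type*} [Field F] [Field M]
    [Differential F] [Differential M] [Algebra F M] [DifferentialAlgebra F M]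
    [CharZero F] {ι : Type*} [Fintype ι]
    (a : F) (c : ι → F) (u : ι → M) (hu : ∀ i, u i ≠ 0) (halg : ∀ i, IsAlgebraic F (u i))
    (h : algebraMap F M a = ∑ i, algebraMap F M (c i) * logDeriv (u i)) :
    ∃ n : ℕ, n ≠ 0 ∧ ∃ v : ι → F, (∀ i, v i ≠ 0) ∧ n * a = ∑ i, c i * logDeriv (v i) := by
  let L := IntermediateField.adjoin F (Set.range u)
  have : FiniteDimensional F L :=
    IntermediateField.finiteDimensional_adjoin (by rintro _ ⟨i, rfl⟩; exact (halg i).isIntegral)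
  let w (i) : L := ⟨u i, IntermediateField.subset_adjoin _ _ ⟨i, rfl⟩⟩
  have hL : algebraMap F L a = ∑ i, algebraMap F L (c i) * logDeriv (w i) := by
    apply FaithfulSMul.algebraMap_injective L M
    simp only [map_sum, map_mul, ← logDeriv_algebraMap, ← IsScalarTower.algebraMap_apply]
    exact h
  let K := IntermediateField.normalClosure F L (AlgebraicClosure L)
  let : Differential K := differentialFiniteDimensional F K
  have : DifferentialAlgebra F K := differentialAlgebraFiniteDimensional
  have : IsGalois F K := { }
  let φ : L →ₐ[F] K := IsScalarTower.toAlgHom F L K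
  refine exists_logDeriv_sum_of_isGalois a c (fun i => φ (w i)) (fun i => ?_) ?_
  · have : w i ≠ 0 := fun hi => hu i (congrArg Subtype.val hi)
    simpa using this
  · have := congrArg φ hL
    simpa [logDeriv, algHom_deriv' φ φ.injective] using this

open Polynomial in
theorem Polynomial.sum_mul_derivative_prod_erase_ne {k : Type*} [Field k] {ι : Type*} [Fintype ι]
    [DecidableEq ι] (c : ι → k) (p : ι → k[X]) (hp : ∀ i, p i ≠ 0) {a : k} (ha : a ≠ 0) :
    C a * ∏ i, p i ≠ ∑ i, C (c i) * (derivative (p i) * ∏ j ∈ Finset.univ.erase i, p j) := by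
  intro h
  have hP : ∏ i, p i ≠ 0 := Finset.prod_ne_zero_iff.2 fun i _ => hp i
  have h1 : (C a * ∏ i, p i).degree = (∏ i, p i).degree := by rw [degree_C_mul ha]
  have h2 : (∑ i, C (c i) * (derivative (p i) * ∏ j ∈ Finset.univ.erase i, p j)).degree
      < (∏ i, p i).degree := by
    refine (degree_sum_le _ _).trans_lt ?_
    rw [Finset.sup_lt_iff (bot_lt_iff_ne_bot.2 (by rwa [Ne, degree_eq_bot]))]
    intro i _
    rw [← smul_eq_C_mul]
    refine (degree_smul_le _ _).trans_lt ?_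
    rw [← Finset.mul_prod_erase _ _ (Finset.mem_univ i), degree_mul, degree_mul]
    refine WithBot.add_lt_add_right ?_ (degree_derivative_lt (hp i))
    rw [Ne, degree_eq_bot, Finset.prod_eq_zero_iff]
    simpa using fun j _ => hp j
  rw [← h, h1] at h2
  exact lt_irrefl _ h2

open Polynomial in
theorem Polynomial.sum_mul_aeval_derivative_div_ne {k M : Type*} [Field k] [Field M]
    [Algebra k M] {h : M} (hh : Transcendental k h) {ι : Type*} [Fintype ι]
    (c : ι → k) (p : ι → k[X]) (hp : ∀ i, p i ≠ 0) {a : k} (ha : a ≠ 0) :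
    algebraMap k M a ≠ ∑ i,
      algebraMap k M (c i) * (aeval h (derivative (p i)) / aeval h (p i)) := by
  classical
  intro H
  have hne (i) : aeval h (p i) ≠ 0 :=
    transcendental_iff_injective.1 hh |>.ne_iff' (map_zero _) |>.2 (hp i)
  refine sum_mul_derivative_prod_erase_ne c p hp ha (transcendental_iff_injective.1 hh ?_)
  simp only [map_mul, map_sum, map_prod, aeval_C, H, Finset.sum_mul]
  refine Finset.sum_congr rfl fun i hi => ?_
  rw [← Finset.mul_prod_erase _ _ hi]
  field_simp [hne i]

open Polynomial in
theorem Derivation.transcendental_of_apply_ne_zero {k M : Type*} [Field k] [CharZero k] [Field M]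
    [Algebra k M] (D : Derivation k M M) {x : M} (hx : D x ≠ 0) : Transcendental k x := by
  intro halg
  have h1 := D.map_aeval (minpoly k x) x
  rw [minpoly.aeval, map_zero, eq_comm, smul_eq_zero, or_iff_left hx] at h1
  exact (minpoly.irreducible halg.isIntegral).separable.aeval_derivative_ne_zero
    (minpoly.aeval k x) h1

open Polynomial IntermediateField in
theorem Derivation.apply_mem_adjoin_simple {k M : Type*} [Field k] [Field M]
    [Algebra k M] (D : Derivation k M M) {h : M} (hD : D h ∈ k⟮h⟯) {y : M} (hy : y ∈ k⟮h⟯) :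
    D y ∈ k⟮h⟯ := by
  have haev (p : k[X]) : aeval h p ∈ k⟮h⟯ := (mem_adjoin_simple_iff k _).2 ⟨p, 1, by simp⟩
  obtain ⟨r, s, rfl⟩ := (mem_adjoin_simple_iff k _).1 hy
  rw [D.leibniz_div, D.map_aeval, D.map_aeval]
  simp only [smul_eq_mul]
  exact mul_mem (pow_mem (inv_mem (haev _)) _) (sub_mem
    (mul_mem (haev _) (mul_mem (haev _) hD)) (mul_mem (haev _) (mul_mem (haev _) hD)))

open Polynomial IntermediateField in
/-- If `D h = 1`, then `1` is not a constant linear combination of logarithmic derivatives of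
elements algebraic over `k(h)`. -/
theorem Derivation.sum_logDeriv_ne_one {k M : Type*} [Field k] [CharZero k] [Field M]
    [Algebra k M] (D : Derivation k M M) {h : M} (hD : D h = 1) {ι : Type*} [Fintype ι]
    (c : ι → k) (u : ι → M) (hu : ∀ i, u i ≠ 0) (halg : ∀ i, IsAlgebraic k⟮h⟯ (u i)) :
    ∑ i, algebraMap k M (c i) * (D (u i) / u i) ≠ 1 := by
  intro H
  have hh : Transcendental k h := D.transcendental_of_apply_ne_zero (by simp [hD])
  have hmem {y : M} (hy : y ∈ k⟮h⟯) : D y ∈ k⟮h⟯ :=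
    D.apply_mem_adjoin_simple (by rw [hD]; exact one_mem _) hy
  let : Differential M := ⟨D.restrictScalars ℤ⟩
  let : Differential k⟮h⟯ := ⟨Derivation.mk'
    { toFun y := ⟨D y, hmem y.2⟩
      map_add' a b := Subtype.ext (by simp)
      map_smul' a b := Subtype.ext (by simp) } fun a b => Subtype.ext (by simp)⟩
  have : DifferentialAlgebra k⟮h⟯ M := ⟨fun _ => rfl⟩
  obtain ⟨n, hn, v, hv, hsum⟩ := Differential.exists_logDeriv_sum_of_isAlgebraic (F := k⟮h⟯)
    1 (fun i => algebraMap k k⟮h⟯ (c i)) u hu halg (by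
      rw [map_one, ← H]
      rfl)
  have hex (i) : ∃ r s : k[X], r ≠ 0 ∧ s ≠ 0 ∧ (v i : M) = aeval h r / aeval h s := by
    obtain ⟨r, s, hrs⟩ := (mem_adjoin_simple_iff k _).1 (v i).2
    have : (v i : M) ≠ 0 := by simpa using hv i
    exact ⟨r, s, by rintro rfl; simp_all, by rintro rfl; simp_all, hrs⟩
  choose r s hr hs hrs using hex
  refine sum_mul_aeval_derivative_div_ne hh (ι := ι ⊕ ι) (a := n) (Sum.elim c (-c)) (Sum.elim r s)
    (by rintro (i | i) <;> simp [hr, hs]) (by simpa) ?_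
  have hM : (n : M) = ∑ i, algebraMap k M (c i) * Differential.logDeriv (v i : M) := by
    have := congrArg (algebraMap k⟮h⟯ M) hsum
    rwa [mul_one, _root_.map_natCast, map_sum] at this
  rw [_root_.map_natCast, hM, Fintype.sum_sum_type, ← Finset.sum_add_distrib]
  refine Finset.sum_congr rfl fun i _ => ?_
  have hne {p : k[X]} (hp : p ≠ 0) : aeval h p ≠ 0 :=
    transcendental_iff_injective.1 hh |>.ne_iff' (map_zero _) |>.2 hp
  change algebraMap k M (c i) * Differential.logDeriv (v i : M) = _
  rw [hrs, Differential.logDeriv_div _ _ (hne (hr i)) (hne (hs i))]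
  have hl (p : k[X]) : Differential.logDeriv (aeval h p) = aeval h (derivative p) / aeval h p := by
    change D _ / _ = _
    rw [D.map_aeval, hD, smul_eq_mul, mul_one]
  simp only [hl, Sum.elim_inl, Sum.elim_inr, Pi.neg_apply, _root_.map_neg]
  ring

open Polynomial in
theorem Polynomial.aevalAeval_eq_eval₂ {k A : Type*} [CommSemiring k] [CommSemiring A]
    [Algebra k A] (x y : A) (P : k[X][X]) :
    aevalAeval x y P = P.eval₂ (aeval (R := k) x : k[X] →+* A) y := by
  induction P using Polynomial.induction_on' with
  | add => simp_all [eval₂_add]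
  | monomial n a =>
    rw [← C_mul_X_pow_eq_monomial, map_mul, map_pow, aevalAeval_C, aevalAeval_Y]
    simp

open Polynomial IntermediateField in
/-- Exchange property for algebraic dependence of two elements. -/
theorem IntermediateField.isAlgebraic_adjoin_simple_of_aevalAeval_eq_zero {k M : Type*}
    [Field k] [Field M] [Algebra k M] {x h : M} (hh : Transcendental k h)
    {P : k[X][X]} (hP : P ≠ 0) (hPxh : aevalAeval x h P = 0) :
    IsAlgebraic k⟮h⟯ x := by
  have hinj : Function.Injective (aeval (R := k) (AdjoinSimple.gen k h)) :=
    transcendental_iff_injective.1 <| (transcendental_algebraMap_iff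
      (FaithfulSMul.algebraMap_injective k⟮h⟯ M)).1 (by simpa using hh)
  refine ⟨(Bivariate.swap P).map (aeval (AdjoinSimple.gen k h)).toRingHom, ?_, ?_⟩
  · rw [Ne, Polynomial.map_eq_zero_iff hinj]
    simpa using hP
  · rw [← Bivariate.aevalAeval_swap] at hPxh
    rw [← hPxh, aevalAeval_eq_eval₂, aeval_def, eval₂_map]
    congr 1
    ext <;> simp

open Polynomial IntermediateField in
/-- If `D x ≠ 0`, `h` and the `u i` are algebraic over `k(x)`, and `D h` is a constant linear
combination of the logarithmic derivatives of the `u i`, then `D h = 0`. -/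
theorem Derivation.apply_eq_zero_of_eq_sum_logDeriv {k M : Type*} [Field k] [CharZero k] [Field M]
    [Algebra k M] (D : Derivation k M M) {x h : M} (hx : D x ≠ 0) {ι : Type*} [Fintype ι]
    (c : ι → k) (u : ι → M) (hu : ∀ i, u i ≠ 0)
    (hh : ∃ P : k[X][X], P ≠ 0 ∧ aevalAeval x h P = 0)
    (halg : ∀ i, ∃ P : k[X][X], P ≠ 0 ∧ aevalAeval x (u i) P = 0)
    (H : D h = ∑ i, algebraMap k M (c i) * (D (u i) / u i)) : D h = 0 := by
  by_contra h0
  have hht : Transcendental k h := D.transcendental_of_apply_ne_zero h0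
  have hxt : Transcendental k x := D.transcendental_of_apply_ne_zero hx
  obtain ⟨P, hP, hP'⟩ := hh
  have hxh : IsAlgebraic k⟮h⟯ x := isAlgebraic_adjoin_simple_of_aevalAeval_eq_zero hht hP hP'
  have hu' (i) : IsAlgebraic k⟮h⟯ (u i) := by
    obtain ⟨Q, hQ, hQ'⟩ := halg i
    let A := algebraicClosure k⟮h⟯ M
    have hxA : x ∈ A := mem_algebraicClosure_iff.2 hxh
    have : IsAlgebraic A (u i) := by
      have hle : k⟮x⟯.toSubalgebra ≤ (A.restrictScalars k).toSubalgebra :=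
        (adjoin_simple_le_iff (K := A.restrictScalars k)).2 hxA
      have h1 : IsAlgebraic k⟮x⟯ (u i) := isAlgebraic_adjoin_simple_of_aevalAeval_eq_zero hxt
        (P := Bivariate.swap Q) (by simpa using hQ) (by rwa [Bivariate.aevalAeval_swap])
      exact h1.tower_top_of_subalgebra_le hle
    exact this.restrictScalars k⟮h⟯
  refine ((D h)⁻¹ • D).sum_logDeriv_ne_one (h := h) (by simp [h0]) c u hu hu' ?_
  rw [← mul_inv_cancel₀ h0, mul_comm]
  nth_rw 3 [H]
  rw [Finset.mul_sum]
  refine Finset.sum_congr rfl fun i _ => ?_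
  simp only [Derivation.smul_apply, smul_eq_mul]
  ring

/-- The ring of germs at `z` of meromorphic functions. -/
def meromorphicGerm (z : ℂ) : Subring (Germ (𝓝[≠] z) ℂ) where
  carrier := {g | ∃ f : ℂ → ℂ, MeromorphicAt f z ∧ (f : Germ (𝓝[≠] z) ℂ) = g}
  zero_mem' := ⟨0, .const 0 z, rfl⟩
  one_mem' := ⟨1, .const 1 z, rfl⟩
  add_mem' := by
    rintro _ _ ⟨f, hf, rfl⟩ ⟨g, hg, rfl⟩
    exact ⟨f + g, hf.add hg, rfl⟩
  mul_mem' := by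
    rintro _ _ ⟨f, hf, rfl⟩ ⟨g, hg, rfl⟩
    exact ⟨f * g, hf.mul hg, rfl⟩
  neg_mem' := by
    rintro _ ⟨f, hf, rfl⟩
    exact ⟨-f, hf.neg, rfl⟩

namespace meromorphicGerm

variable {z : ℂ}

/-- The germ of a meromorphic function. -/
noncomputable def mk (f : ℂ → ℂ) (hf : MeromorphicAt f z) : meromorphicGerm z := ⟨f, f, hf, rfl⟩

theorem mk_surjective (g : meromorphicGerm z) : ∃ f hf, mk f hf = g := by
  obtain ⟨_, f, hf, rfl⟩ := g
  exact ⟨f, hf, rfl⟩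

theorem mk_eq_mk {f g : ℂ → ℂ} {hf : MeromorphicAt f z} {hg : MeromorphicAt g z} :
    mk f hf = mk g hg ↔ f =ᶠ[𝓝[≠] z] g :=
  Subtype.ext_iff.trans Germ.coe_eq

theorem mk_eq_zero {f : ℂ → ℂ} {hf : MeromorphicAt f z} : mk f hf = 0 ↔ f =ᶠ[𝓝[≠] z] 0 :=
  mk_eq_mk (hg := .const 0 z)

noncomputable instance : Field (meromorphicGerm z) where
  inv g := ⟨(g : Germ (𝓝[≠] z) ℂ)⁻¹, by
    obtain ⟨f, hf, rfl⟩ := mk_surjective g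
    exact ⟨f⁻¹, hf.inv, rfl⟩⟩
  exists_pair_ne := ⟨0, 1, fun h => by simpa using congrArg Subtype.val h⟩
  mul_inv_cancel g hg := by
    obtain ⟨f, hf, rfl⟩ := mk_surjective g
    refine mk_eq_mk (hf := hf.mul hf.inv) (hg := .const 1 z) |>.2 ?_
    have := hf.eventually_eq_zero_or_eventually_ne_zero.resolve_left (mt mk_eq_zero.2 hg)
    filter_upwards [this] with w hw using mul_inv_cancel₀ hw
  inv_zero := mk_eq_mk (hf := (MeromorphicAt.const 0 z).inv) (hg := .const 0 z) |>.2 <|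
    .of_forall fun _ => inv_zero
  nnqsmul := _
  nnqsmul_def _ _ := rfl
  qsmul := _
  qsmul_def _ _ := rfl

noncomputable instance : Algebra ℂ (meromorphicGerm z) :=
  RingHom.toAlgebra
    { toFun c := mk (fun _ => c) (.const c z)
      map_one' := rfl
      map_mul' _ _ := rfl
      map_zero' := rfl
      map_add' _ _ := rfl }

/-- Differentiation of germs of meromorphic functions. -/
noncomputable def derivFun (g : meromorphicGerm z) : meromorphicGerm z :=
  ⟨(g : Germ (𝓝[≠] z) ℂ).map' deriv fun _ _ h => h.nhdsNE_deriv, by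
    obtain ⟨f, hf, rfl⟩ := mk_surjective g
    exact ⟨deriv f, hf.deriv, rfl⟩⟩

theorem _root_.MeromorphicAt.eventually_differentiableAt {f : ℂ → ℂ} (hf : MeromorphicAt f z) :
    ∀ᶠ w in 𝓝[≠] z, DifferentiableAt ℂ f w :=
  hf.eventually_analyticAt.mono fun _ h => h.differentiableAt

theorem derivFun_mul (a b : meromorphicGerm z) :
    derivFun (a * b) = a * derivFun b + b * derivFun a := by
  obtain ⟨f, hf, rfl⟩ := mk_surjective a
  obtain ⟨g, hg, rfl⟩ := mk_surjective b
  refine mk_eq_mk (hf := (hf.mul hg).deriv) (hg := (hf.mul hg.deriv).add (hg.mul hf.deriv)) |>.2 ?_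
  filter_upwards [hf.eventually_differentiableAt, hg.eventually_differentiableAt] with w h1 h2
  simp only [deriv_mul h1 h2, Pi.add_apply, Pi.mul_apply]
  ring

variable (z) in
/-- Differentiation as a derivation on germs of meromorphic functions. -/
noncomputable def derivation : Derivation ℂ (meromorphicGerm z) (meromorphicGerm z) :=
  Derivation.mk'
    { toFun := derivFun
      map_add' a b := by
        obtain ⟨f, hf, rfl⟩ := mk_surjective a
        obtain ⟨g, hg, rfl⟩ := mk_surjective b
        refine mk_eq_mk (hf := (hf.add hg).deriv) (hg := hf.deriv.add hg.deriv) |>.2 ?_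
        filter_upwards [hf.eventually_differentiableAt, hg.eventually_differentiableAt]
          with w h1 h2 using deriv_add h1 h2
      map_smul' c a := by
        have hc : derivFun (algebraMap ℂ (meromorphicGerm z) c) = 0 :=
          mk_eq_mk (hf := (MeromorphicAt.const c z).deriv) (hg := .const 0 z) |>.2 <|
            .of_forall fun w => deriv_const w c
        simp [Algebra.smul_def, derivFun_mul, hc] }
    derivFun_mul

open Polynomial in
theorem aeval_mk (f : ℂ → ℂ) (hf : MeromorphicAt f z) (p : ℂ[X]) :
    ((aeval (mk f hf) p : meromorphicGerm z) : Germ (𝓝[≠] z) ℂ) = ↑fun w => p.eval (f w) := by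
  induction p using Polynomial.induction_on' with
  | add p q hp hq =>
    simp only [map_add, eval_add, Subring.coe_add, hp, hq]
    rfl
  | monomial n a =>
    simp only [aeval_monomial, eval_monomial]
    rfl

open Polynomial in
theorem aevalAeval_mk (f g : ℂ → ℂ) (hf : MeromorphicAt f z) (hg : MeromorphicAt g z)
    (P : ℂ[X][X]) :
    ((aevalAeval (mk f hf) (mk g hg) P : meromorphicGerm z) : Germ (𝓝[≠] z) ℂ) =
      ↑fun w => evalEval (f w) (g w) P := by
  induction P using Polynomial.induction_on' with
  | add p q hp hq =>
    simp only [map_add, evalEval_add, Subring.coe_add, hp, hq]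
    rfl
  | monomial n p =>
    rw [← C_mul_X_pow_eq_monomial, map_mul, map_pow, aevalAeval_C, aevalAeval_Y]
    simp only [Subring.coe_mul, aeval_mk, evalEval_mul, evalEval_C, evalEval_pow, evalEval_X]
    rfl

end meromorphicGerm

open Polynomial in
/-- If `h` and the `u i` are algebraic functions with `h' = ∑ i, c i * (u i)' / u i` near `z`, then
`h' = 0` near `z`. -/
theorem AnalyticAt.eventually_deriv_eq_zero_of_eq_sum_logDeriv {z : ℂ} {ι : Type*} [Fintype ι]
    {h : ℂ → ℂ} {u : ι → ℂ → ℂ} (hh : AnalyticAt ℂ h z) (hu : ∀ i, AnalyticAt ℂ (u i) z)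
    (hu0 : ∀ i, u i z ≠ 0) (c : ι → ℂ)
    (hP : ∃ P : ℂ[X][X], P ≠ 0 ∧ ∀ᶠ w in 𝓝 z, evalEval w (h w) P = 0)
    (hQ : ∀ i, ∃ P : ℂ[X][X], P ≠ 0 ∧ ∀ᶠ w in 𝓝 z, evalEval w (u i w) P = 0)
    (H : ∀ᶠ w in 𝓝 z, deriv h w = ∑ i, c i * logDeriv (u i) w) :
    ∀ᶠ w in 𝓝 z, deriv h w = 0 := by
  let x : meromorphicGerm z := meromorphicGerm.mk id analyticAt_id.meromorphicAt
  let g : meromorphicGerm z := meromorphicGerm.mk h hh.meromorphicAt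
  let v (i) : meromorphicGerm z := meromorphicGerm.mk (u i) (hu i).meromorphicAt
  have hx : meromorphicGerm.derivation z x ≠ 0 := by
    have : meromorphicGerm.derivation z x = 1 :=
      meromorphicGerm.mk_eq_mk (hf := analyticAt_id.meromorphicAt.deriv) (hg := .const 1 z) |>.2 <|
        .of_forall fun w => deriv_id w
    simp [this]
  have hv (i) : v i ≠ 0 := fun hi => by
    have h1 := meromorphicGerm.mk_eq_zero.1 hi
    have h2 := (hu i).continuousAt.eventually_ne (hu0 i)
    obtain ⟨w, hw⟩ := (h1.and (h2.filter_mono nhdsWithin_le_nhds)).exists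
    exact hw.2 hw.1
  have hzero {f : ℂ → ℂ} (hf : AnalyticAt ℂ f z)
      (hex : ∃ P : ℂ[X][X], P ≠ 0 ∧ ∀ᶠ w in 𝓝 z, evalEval w (f w) P = 0) :
      ∃ P : ℂ[X][X], P ≠ 0 ∧ aevalAeval x (meromorphicGerm.mk f hf.meromorphicAt) P = 0 := by
    obtain ⟨P, hP, hP'⟩ := hex
    refine ⟨P, hP, Subtype.ext ?_⟩
    rw [meromorphicGerm.aevalAeval_mk]
    exact Germ.coe_eq.2 (hP'.filter_mono nhdsWithin_le_nhds)
  have key := (meromorphicGerm.derivation z).apply_eq_zero_of_eq_sum_logDeriv hx c v hv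
    (hzero hh hP) (fun i => hzero (hu i) (hQ i)) (h := g) (Subtype.ext ?_)
  · have h1 : deriv h =ᶠ[𝓝[≠] z] 0 :=
      (meromorphicGerm.mk_eq_zero (hf := hh.meromorphicAt.deriv)).1 key
    exact (hh.deriv.frequently_eq_iff_eventually_eq analyticAt_const).1 h1.frequently
  · have (s : Finset ι) : ((∑ i ∈ s, algebraMap ℂ (meromorphicGerm z) (c i) *
        (meromorphicGerm.derivation z (v i) / v i) : meromorphicGerm z) : Germ (𝓝[≠] z) ℂ) =
        ↑fun w => ∑ i ∈ s, c i * logDeriv (u i) w := by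
      classical
      induction s using Finset.induction_on with
      | empty => simp; rfl
      | insert i s hi ih =>
        rw [Finset.sum_insert hi, Subring.coe_add, ih, div_eq_mul_inv]
        simp only [Finset.sum_insert hi, logDeriv_apply, div_eq_mul_inv]
        rfl
    rw [this]
    exact Germ.coe_eq.2 (H.filter_mono nhdsWithin_le_nhds)

theorem deriv_eq_sum_logDeriv_of_exp_eq_prod_cpow {z : ℂ} {ι : Type*} [Fintype ι]
    {h : ℂ → ℂ} {u : ι → ℂ → ℂ} (hh : DifferentiableAt ℂ h z)
    (hu : ∀ i, DifferentiableAt ℂ (u i) z) (hu0 : ∀ i, u i z ∈ slitPlane) (c : ι → ℂ)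
    (H : ∀ᶠ w in 𝓝 z, exp (h w) = ∏ i, u i w ^ c i) :
    deriv h z = ∑ i, c i * logDeriv (u i) z := by
  have hd (i) := (hu i).hasDerivAt.cpow_const (c := c i) (hu0 i)
  have hne (i) : u i z ≠ 0 := slitPlane_ne_zero (hu0 i)
  have h1 : logDeriv (fun w => exp (h w)) z = deriv h z := by
    rw [logDeriv_apply, hh.hasDerivAt.cexp.deriv, mul_div_cancel_left₀ _ (exp_ne_zero _)]
  have h2 : logDeriv (fun w => ∏ i, u i w ^ c i) z = ∑ i, c i * logDeriv (u i) z := by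
    rw [logDeriv_prod (fun i _ => by simp [cpow_eq_zero_iff, hne])
      fun i _ => (hd i).differentiableAt]
    refine Finset.sum_congr rfl fun i _ => ?_
    rw [logDeriv_apply, (hd i).deriv, cpow_sub _ _ (hne i), cpow_one, logDeriv_apply]
    have : u i z ^ c i ≠ 0 := by simp [cpow_eq_zero_iff, hne]
    field_simp [hne i]
  have H' : (fun w => exp (h w)) =ᶠ[𝓝 z] fun w => ∏ i, u i w ^ c i := H
  rw [← h1, ← h2, logDeriv_apply, logDeriv_apply, H'.deriv_eq, H'.eq_of_nhds]

theorem MvPolynomial.exists_eval_ne_zero_of_isOpen {κ : Type*} [Fintype κ]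
    {p : MvPolynomial κ ℂ} (hp : p ≠ 0) {W : Set (κ → ℂ)} (hW : IsOpen W) (hne : W.Nonempty) :
    ∃ a ∈ W, eval a p ≠ 0 := by
  by_contra! hcon
  obtain ⟨a, ha⟩ := hne
  obtain ⟨r, hr, hball⟩ := Metric.isOpen_iff.1 hW a ha
  rw [ball_pi _ hr] at hball
  refine hp (funext_set (fun i => Metric.ball (a i) r) (fun i => ?_) fun x hx => ?_)
  · exact infinite_of_mem_nhds (a i) (Metric.ball_mem_nhds _ hr)
  · simpa using hcon x (hball hx)

/-- The restriction of a polynomial to the line through `a` and `b`. -/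
noncomputable def MvPolynomial.restrictLine {κ : Type*} (a b : κ → ℂ) :
    MvPolynomial κ ℂ →+* Polynomial ℂ :=
  (aeval fun i => Polynomial.C (a i) + Polynomial.X * Polynomial.C (b i - a i) :
    MvPolynomial κ ℂ →ₐ[ℂ] Polynomial ℂ)

theorem MvPolynomial.eval_restrictLine {κ : Type*} (a b : κ → ℂ) (p : MvPolynomial κ ℂ) (w : ℂ) :
    (restrictLine a b p).eval w = eval (a + w • (b - a)) p := by
  induction p using MvPolynomial.induction_on with
  | C c => simp [restrictLine]
  | add p q hp hq => simp [hp, hq]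
  | mul_X p i hp =>
    simp only [map_mul, Polynomial.eval_mul, hp, eval_X]
    simp [restrictLine]

open Polynomial in
theorem MvPolynomial.evalEval_map_restrictLine {κ : Type*} (a b : κ → ℂ)
    (P : Polynomial (MvPolynomial κ ℂ)) (w y : ℂ) :
    evalEval w y (P.map (restrictLine a b)) = P.eval₂ (eval (a + w • (b - a))) y := by
  induction P using Polynomial.induction_on' with
  | add p q hp hq => simp [hp, hq, Polynomial.eval₂_add, evalEval_add]
  | monomial n p =>
    rw [Polynomial.map_monomial, ← Polynomial.C_mul_X_pow_eq_monomial, Polynomial.eval₂_monomial]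
    simp [evalEval_mul, evalEval_pow, evalEval_C, evalEval_X, eval_restrictLine]

theorem MvPolynomial.map_restrictLine_ne_zero {κ : Type*} {a : κ → ℂ} (b : κ → ℂ)
    {P : Polynomial (MvPolynomial κ ℂ)} (ha : eval a P.leadingCoeff ≠ 0) :
    P.map (restrictLine a b) ≠ 0 := by
  intro h
  have h1 := congrArg (fun q => (Polynomial.coeff q P.natDegree).eval 0) h
  simp only [Polynomial.coeff_map, eval_restrictLine] at h1
  exact ha (by simpa using h1)

/-- The case where the domain is a ball. -/
theorem NashAlgebraicOn.eq_of_exp_eq_prod_cpow_on_ball {κ : ℕ} {ι : Type*} [Fintype ι]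
    {p : Fin κ → ℂ} {r : ℝ} {H : (Fin κ → ℂ) → ℂ} {Hs : ι → (Fin κ → ℂ) → ℂ}
    (hH : NashAlgebraicOn H (Metric.ball p r)) (hHs : ∀ k, NashAlgebraicOn (Hs k) (Metric.ball p r))
    (hslit : ∀ k, ∀ ξ ∈ Metric.ball p r, Hs k ξ ∈ slitPlane) (μ : ι → ℂ)
    (heq : ∀ ξ ∈ Metric.ball p r, exp (H ξ) = ∏ k, Hs k ξ ^ μ k)
    {a₀ b : Fin κ → ℂ} (ha₀ : a₀ ∈ Metric.ball p r) (hb : b ∈ Metric.ball p r) : H a₀ = H b := by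
  by_contra hne
  obtain ⟨hHd, P, hP, hPH⟩ := hH
  choose hHsd Q hQ hQH using hHs
  let W := Metric.ball p r ∩ H ⁻¹' {H b}ᶜ
  have hW : IsOpen W :=
    hHd.continuousOn.isOpen_inter_preimage Metric.isOpen_ball isOpen_compl_singleton
  have hlead : P.leadingCoeff * ∏ k, (Q k).leadingCoeff ≠ 0 :=
    mul_ne_zero (by simpa) (Finset.prod_ne_zero_iff.2 fun k _ => by simpa using hQ k)
  obtain ⟨a, ⟨ha, hab⟩, ha0⟩ :=
    MvPolynomial.exists_eval_ne_zero_of_isOpen hlead hW ⟨a₀, ha₀, hne⟩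
  rw [map_mul, map_prod, mul_ne_zero_iff, Finset.prod_ne_zero_iff] at ha0
  obtain ⟨ℓ, hℓdef⟩ : ∃ ℓ : ℂ → Fin κ → ℂ, ∀ t, ℓ t = a + t • (b - a) := ⟨_, fun _ => rfl⟩
  have hℓ : Differentiable ℂ ℓ := by
    rw [funext hℓdef]
    fun_prop
  obtain ⟨U, hUdef⟩ : ∃ U, U = ℓ ⁻¹' Metric.ball p r := ⟨_, rfl⟩
  have hmem {t : ℂ} (ht : t ∈ U) : ℓ t ∈ Metric.ball p r := by rwa [hUdef] at ht
  have hU : IsOpen U := hUdef ▸ Metric.isOpen_ball.preimage hℓ.continuous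
  have hUconv : Convex ℝ U := fun s hs t ht α β hα hβ hαβ => by
    have h1 : ℓ (α • s + β • t) = α • ℓ s + β • ℓ t := by
      have h2 : (α : ℂ) + β = 1 := by exact_mod_cast hαβ
      ext i
      simp only [hℓdef, Pi.add_apply, Pi.smul_apply, Pi.sub_apply, smul_eq_mul, real_smul]
      linear_combination (-a i) * h2
    rw [hUdef, Set.mem_preimage, h1]
    exact convex_ball p r (hmem hs) (hmem ht) hα hβ hαβ
  have hcomp {f : (Fin κ → ℂ) → ℂ} (hf : DifferentiableOn ℂ f (Metric.ball p r)) :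
      DifferentiableOn ℂ (f ∘ ℓ) U := hf.comp hℓ.differentiableOn fun _ => hmem
  have hpoly {f : (Fin κ → ℂ) → ℂ} {R : Polynomial (MvPolynomial (Fin κ) ℂ)}
      (hR : MvPolynomial.eval a R.leadingCoeff ≠ 0)
      (hf : ∀ ξ ∈ Metric.ball p r, R.eval₂ (MvPolynomial.eval ξ) (f ξ) = 0) {t : ℂ} (ht : t ∈ U) :
      ∃ S : Polynomial (Polynomial ℂ), S ≠ 0 ∧ ∀ᶠ w in 𝓝 t, S.evalEval w (f (ℓ w)) = 0 :=
    ⟨R.map (MvPolynomial.restrictLine a b), MvPolynomial.map_restrictLine_ne_zero b hR, by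
      filter_upwards [hU.mem_nhds ht] with w hw
      rw [MvPolynomial.evalEval_map_restrictLine, ← hℓdef]
      exact hf _ (hmem hw)⟩
  have hderiv : ∀ t ∈ U, deriv (H ∘ ℓ) t = 0 := fun t ht => by
    refine (AnalyticAt.eventually_deriv_eq_zero_of_eq_sum_logDeriv (u := fun k => Hs k ∘ ℓ)
      ((hcomp hHd).analyticAt (hU.mem_nhds ht))
      (fun k => (hcomp (hHsd k)).analyticAt (hU.mem_nhds ht))
      (fun k => slitPlane_ne_zero (hslit k _ (hmem ht))) μ (hpoly ha0.1 hPH ht)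
      (fun k => hpoly (ha0.2 k (Finset.mem_univ k)) (hQH k) ht) ?_).self_of_nhds
    filter_upwards [hU.mem_nhds ht] with w hw
    exact deriv_eq_sum_logDeriv_of_exp_eq_prod_cpow ((hcomp hHd).differentiableAt (hU.mem_nhds hw))
      (fun k => (hcomp (hHsd k)).differentiableAt (hU.mem_nhds hw)) (fun k => hslit k _ (hmem hw)) μ
      (by filter_upwards [hU.mem_nhds hw] with v hv using heq _ (hmem hv))
  have h01 := hU.is_const_of_deriv_eq_zero hUconv.isPreconnected (hcomp hHd) hderiv
    (x := 0) (y := 1) (by simpa [hUdef, hℓdef] using ha) (by simpa [hUdef, hℓdef] using hb)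
  exact hab (by simpa [hℓdef] using h01)

theorem NashAlgebraicOn.mono {κ : ℕ} {H : (Fin κ → ℂ) → ℂ} {V W : Set (Fin κ → ℂ)}
    (hH : NashAlgebraicOn H V) (hWV : W ⊆ V) : NashAlgebraicOn H W :=
  ⟨hH.1.mono hWV, hH.2.imp fun _ hP => ⟨hP.1, fun ξ hξ => hP.2 ξ (hWV hξ)⟩⟩

/-- Lemma 2.2 of Huang–Yuan: if `exp(H) = ∏ H_k^{μ_k}` on a connected open set with
`H, H₁, …, H_K` Nash algebraic and the `H_k` avoiding the nonpositive real axis,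
then `H` is constant. -/
theorem stmt1 {κ K : ℕ} (V : Set (Fin κ → ℂ)) (hVopen : IsOpen V) (hVconn : IsConnected V)
    (H : (Fin κ → ℂ) → ℂ) (Hs : Fin K → (Fin κ → ℂ) → ℂ)
    (hH : NashAlgebraicOn H V) (hHs : ∀ k, NashAlgebraicOn (Hs k) V)
    (hslit : ∀ k, ∀ ξ ∈ V, Hs k ξ ∈ Complex.slitPlane)
    (μ : Fin K → ℝ)
    (heq : ∀ ξ ∈ V, Complex.exp (H ξ) = ∏ k : Fin K, (Hs k ξ) ^ ((μ k : ℂ))) :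
    ∃ C : ℂ, ∀ ξ ∈ V, H ξ = C := by
  obtain ⟨ξ₀, hξ₀⟩ := hVconn.nonempty
  refine ⟨H ξ₀, fun ξ hξ => hVopen.is_const_of_fderiv_eq_zero (𝕜 := ℂ) hVconn.isPreconnected hH.1
    (fun p hp => ?_) hξ hξ₀⟩
  obtain ⟨r, hr, hball⟩ := Metric.isOpen_iff.1 hVopen p hp
  have hloc : H =ᶠ[𝓝 p] fun _ => H p := by
    filter_upwards [Metric.ball_mem_nhds p hr] with q hq
    exact (hH.mono hball).eq_of_exp_eq_prod_cpow_on_ball (fun k => (hHs k).mono hball)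
      (fun k q hq => hslit k q (hball hq)) (fun k => (μ k : ℂ)) (fun q hq => heq q (hball hq)) hq
      (Metric.mem_ball_self hr)
  simpa using hloc.fderiv_eq (𝕜 := ℂ)
end

section
/- Let p ∈ ℂ^n, let φ₁,…,φ_N be holomorphic functions on a neighborhood of p with φ_i(p) = 0 for all i, let 0 ≤ s ≤ N, and set D(z) = Σ_{i=1}^s |φ_i(z)|² − Σ_{i=s+1}^N |φ_i(z)|². Assume D is in Bochner form at p. Then the determinant of the n×n matrix [∂²D/∂z_a ∂z̄_b]_{a,b=1,…,n} belongs to Λ̃_p: there exist a ∈ ℝ and a tuple α of holomorphic functions vanishing at p such that det[∂²D/∂z_a ∂z̄_b] = a + ⟨α,α⟩_ℓ on a neighborhood of p. -/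
open Filter Topology Complex

/-- Wirtinger derivative `∂F/∂z_j = ½(∂F/∂x_j − i ∂F/∂y_j)`. -/
noncomputable def wderiv {n : ℕ} (j : Fin n) (F : (Fin n → ℂ) → ℂ) (z : Fin n → ℂ) : ℂ :=
  (1 / 2 : ℂ) * (fderiv ℝ F z (Pi.single j 1) - Complex.I * fderiv ℝ F z (Pi.single j Complex.I))

/-- Conjugate Wirtinger derivative `∂F/∂z̄_j = ½(∂F/∂x_j + i ∂F/∂y_j)`. -/
noncomputable def wderivBar {n : ℕ} (j : Fin n) (F : (Fin n → ℂ) → ℂ) (z : Fin n → ℂ) : ℂ :=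
  (1 / 2 : ℂ) * (fderiv ℝ F z (Pi.single j 1) + Complex.I * fderiv ℝ F z (Pi.single j Complex.I))

/-- `⟨α,α⟩_ℓ(z)` as a complex number. -/
noncomputable def hermC {n m : ℕ} (ℓ : ℕ) (α : Fin m → (Fin n → ℂ) → ℂ)
    (z : Fin n → ℂ) : ℂ :=
  ∑ j : Fin m, (if (j : ℕ) < ℓ then (1 : ℂ) else -1) *
    (α j z * (starRingEnd ℂ) (α j z))

/-- A real-analytic function `D` is in Bochner form at `p` if, writing
`D(z) = E(z, z̄)` for a holomorphic function `E` of `2n` variables near `(p, p̄)`,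
the remainder `R(z,w) = E(z,w) − Σ_j (z_j − p_j)(w_j − p̄_j)` vanishes to order `≥ 2`
at `p` in `z` (for every `w`) and to order `≥ 2` at `p̄` in `w` (for every `z`);
i.e. its expansion is `|z − p|² + Σ_{|j|≥2, |k|≥2} b_{jk}(z−p)^j (z̄−p̄)^k`. -/
def IsBochnerAt {n : ℕ} (D : (Fin n → ℂ) → ℂ) (p : Fin n → ℂ) : Prop :=
  ∃ (E : (Fin n → ℂ) → (Fin n → ℂ) → ℂ) (U V : Set (Fin n → ℂ)),
    IsOpen U ∧ IsOpen V ∧ p ∈ U ∧ star p ∈ V ∧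
    DifferentiableOn ℂ (fun zw : (Fin n → ℂ) × (Fin n → ℂ) => E zw.1 zw.2) (U ×ˢ V) ∧
    (∀ᶠ z in 𝓝 p, D z = E z (star z)) ∧
    (let R : (Fin n → ℂ) → (Fin n → ℂ) → ℂ := fun z w =>
       E z w - ∑ j : Fin n, (z j - p j) * (w j - (starRingEnd ℂ) (p j))
     (∀ w ∈ V, R p w = 0 ∧ fderiv ℂ (fun z => R z w) p = 0) ∧
     (∀ z ∈ U, R z (star p) = 0 ∧ fderiv ℂ (fun w => R z w) (star p) = 0))

/-- A holomorphic function of `(z, w)` that vanishes on the totally real set `w = z̄` near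
`(p, p̄)` vanishes in a neighborhood of `(p, p̄)`. -/
theorem eventually_eq_zero_of_eventually_eq_zero_star {n : ℕ} {p : Fin n → ℂ}
    {F : (Fin n → ℂ) × (Fin n → ℂ) → ℂ}
    (hF : ∀ᶠ x in 𝓝 (p, star p), DifferentiableAt ℂ F x)
    (h0 : ∀ᶠ z in 𝓝 p, F (z, star z) = 0) :
    ∀ᶠ x in 𝓝 (p, star p), F x = 0 := by
  obtain ⟨r₁, hr₁, hd⟩ := Metric.eventually_nhds_iff_ball.1 hF
  obtain ⟨r₂, hr₂, hz⟩ := Metric.eventually_nhds_iff_ball.1 h0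
  set r := min r₁ r₂ with hr
  have hrpos : 0 < r := lt_min hr₁ hr₂
  refine Metric.eventually_nhds_iff_ball.2 ⟨r / 3, by positivity, fun x hx => ?_⟩
  obtain ⟨ζ, hζ⟩ : ∃ ζ, ζ = x.1 - p := ⟨_, rfl⟩
  obtain ⟨η, hη⟩ : ∃ η, η = star x.2 - p := ⟨_, rfl⟩
  have hζr : ‖ζ‖ < r / 3 := by
    rw [hζ, ← dist_eq_norm]
    exact lt_of_le_of_lt (le_max_left _ _) hx
  have hηr : ‖η‖ < r / 3 := by
    have h1 : ‖η‖ = dist x.2 (star p) := by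
      rw [hη, dist_eq_norm, ← norm_star (x.2 - star p), star_sub, star_star]
    rw [h1]
    exact lt_of_le_of_lt (le_max_right _ _) hx
  set A : Fin n → ℂ := (1 / 2 : ℂ) • (ζ + η) with hA
  set B : Fin n → ℂ := (-I / 2 : ℂ) • (ζ - η) with hB
  have hAr : ‖A‖ < r / 3 := by
    have h1 : ‖A‖ = 1 / 2 * ‖ζ + η‖ := by rw [hA, norm_smul]; norm_num
    have := norm_add_le ζ η
    linarith
  have hBr : ‖B‖ < r / 3 := by
    have h1 : ‖B‖ = 1 / 2 * ‖ζ - η‖ := by rw [hB, norm_smul]; norm_num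
    have := norm_sub_le ζ η
    linarith
  let L : ℂ → (Fin n → ℂ) × (Fin n → ℂ) :=
    fun t => (p + (A + t • B), star p + (star A + t • star B))
  have hbound : ∀ (a b : Fin n → ℂ) (t : ℂ), ‖a‖ < r / 3 → ‖b‖ < r / 3 → ‖t‖ < 2 →
      ‖a + t • b‖ < r := by
    intro a b t ha hb ht
    have h1 := norm_add_le a (t • b)
    rw [norm_smul] at h1
    have h2 : ‖t‖ * ‖b‖ ≤ 2 * ‖b‖ := by gcongr
    linarith
  have hLmem : ∀ t ∈ Metric.ball (0 : ℂ) 2, L t ∈ Metric.ball (p, star p) r := by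
    intro t ht
    rw [mem_ball_zero_iff] at ht
    rw [Metric.mem_ball, dist_eq_norm]
    refine max_lt ?_ ?_
    · simpa [L] using hbound A B t hAr hBr ht
    · simpa [L] using hbound (star A) (star B) t (by simpa using hAr) (by simpa using hBr) ht
  have hLd : Differentiable ℂ L := by
    dsimp only [L]
    fun_prop
  have hg : AnalyticOnNhd ℂ (F ∘ L) (Metric.ball 0 2) := by
    refine DifferentiableOn.analyticOnNhd (fun t ht => ?_) Metric.isOpen_ball
    refine ((hd (L t) ?_).comp t (hLd t)).differentiableWithinAt
    exact Metric.ball_subset_ball (min_le_left _ _) (hLmem t ht)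
  have hreal : ∀ᶠ t : ℝ in 𝓝[≠] 0, (F ∘ L) (t : ℂ) = 0 := by
    have h2 : ∀ᶠ t : ℝ in 𝓝 0, t ∈ Metric.ball (0 : ℝ) 2 :=
      Metric.ball_mem_nhds _ (by norm_num)
    filter_upwards [nhdsWithin_le_nhds h2] with t ht
    have ht' : (t : ℂ) ∈ Metric.ball (0 : ℂ) 2 := by
      rw [mem_ball_zero_iff] at ht ⊢
      simpa using ht
    have h3 : (L t).2 = star (L t).1 := by
      ext j
      simp [L]
    have h4 : (L t).1 ∈ Metric.ball p r₂ :=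
      lt_of_le_of_lt (le_max_left _ _ : _ ≤ dist (L t) (p, star p))
        (Metric.ball_subset_ball (min_le_right _ _) (hLmem t ht'))
    have h5 := hz _ h4
    rw [← h3] at h5
    exact h5
  have htend : Tendsto (fun t : ℝ => (t : ℂ)) (𝓝[≠] 0) (𝓝[≠] 0) := by
    refine tendsto_nhdsWithin_iff.2 ⟨?_, ?_⟩
    · exact (Complex.continuous_ofReal.tendsto' 0 0 (by simp)).mono_left nhdsWithin_le_nhds
    · filter_upwards [self_mem_nhdsWithin] with t ht
      simpa using ht
  have hzero := hg.eqOn_zero_of_preconnected_of_frequently_eq_zero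
    (convex_ball 0 2).isPreconnected (Metric.mem_ball_self two_pos)
    (htend.frequently hreal.frequently)
  have hI : L I = x := by
    refine Prod.ext ?_ ?_ <;> ext j
    · simp only [L, hA, hB, hζ, hη, Pi.add_apply, Pi.smul_apply, Pi.sub_apply, Pi.star_apply,
        smul_eq_mul]
      linear_combination (-(1 / 2 : ℂ) * (x.1 j - p j - (star (x.2 j) - p j))) * I_mul_I
    · simp only [L, hA, hB, hζ, hη, Pi.add_apply, Pi.smul_apply, Pi.sub_apply, Pi.star_apply,
        smul_eq_mul, star_mul', star_add, star_sub, star_div₀, star_neg, star_one,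
        star_ofNat, RCLike.star_def, conj_I]
      simp only [Complex.conj_conj]
      linear_combination
        ((1 / 2 : ℂ) * ((starRingEnd ℂ) (x.1 j) - x.2 j)) * I_mul_I
  have := hzero (show I ∈ Metric.ball (0 : ℂ) 2 by simp)
  simpa [hI] using this

section Wirtinger

variable {n : ℕ} {ι : Type*} [Fintype ι] {ε : ι → ℂ} {f g : ι → (Fin n → ℂ) → ℂ}
  {z : Fin n → ℂ}

theorem fderiv_real_sum_mul_conj_apply (hf : ∀ i, DifferentiableAt ℂ (f i) z)
    (hg : ∀ i, DifferentiableAt ℂ (g i) z) (v : Fin n → ℂ) :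
    fderiv ℝ (fun z => ∑ i, ε i * (f i z * (starRingEnd ℂ) (g i z))) z v =
      ∑ i, ε i * (f i z * (starRingEnd ℂ) (fderiv ℂ (g i) z v) +
        fderiv ℂ (f i) z v * (starRingEnd ℂ) (g i z)) := by
  have key : ∀ i, HasFDerivAt (fun z => ε i * (f i z * (starRingEnd ℂ) (g i z)))
      (ε i • (f i z • ((conjCLE : ℂ →L[ℝ] ℂ).comp ((fderiv ℂ (g i) z).restrictScalars ℝ)) +
        (starRingEnd ℂ) (g i z) • (fderiv ℂ (f i) z).restrictScalars ℝ)) z := by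
    intro i
    have h1 := (hf i).hasFDerivAt.restrictScalars ℝ
    have h2 : HasFDerivAt (fun z => (starRingEnd ℂ) (g i z)) _ z :=
      (conjCLE : ℂ →L[ℝ] ℂ).hasFDerivAt.comp z ((hg i).hasFDerivAt.restrictScalars ℝ)
    exact (h1.mul h2).const_mul (ε i)
  rw [(HasFDerivAt.fun_sum fun i _ => key i).fderiv]
  simp [mul_add, mul_comm]

theorem fderiv_single_I (h : (Fin n → ℂ) → ℂ) (j : Fin n) :
    fderiv ℂ h z (Pi.single j I) = I * fderiv ℂ h z (Pi.single j 1) := by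
  have : (Pi.single j I : Fin n → ℂ) = I • Pi.single j 1 := by
    rw [← Pi.single_smul]; simp
  rw [this, map_smul, smul_eq_mul]

theorem wderivBar_sum_mul_conj (hf : ∀ i, DifferentiableAt ℂ (f i) z)
    (hg : ∀ i, DifferentiableAt ℂ (g i) z) (j : Fin n) :
    wderivBar j (fun z => ∑ i, ε i * (f i z * (starRingEnd ℂ) (g i z))) z =
      ∑ i, ε i * (f i z * (starRingEnd ℂ) (fderiv ℂ (g i) z (Pi.single j 1))) := by
  simp only [wderivBar, fderiv_real_sum_mul_conj_apply hf hg, fderiv_single_I, Finset.mul_sum,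
    ← Finset.sum_add_distrib, map_mul, conj_I]
  refine Finset.sum_congr rfl fun i _ => ?_
  linear_combination (ε i / 2 * (fderiv ℂ (f i) z (Pi.single j 1) * (starRingEnd ℂ) (g i z)
    - f i z * (starRingEnd ℂ) (fderiv ℂ (g i) z (Pi.single j 1)))) * I_mul_I

theorem wderiv_sum_mul_conj (hf : ∀ i, DifferentiableAt ℂ (f i) z)
    (hg : ∀ i, DifferentiableAt ℂ (g i) z) (j : Fin n) :
    wderiv j (fun z => ∑ i, ε i * (f i z * (starRingEnd ℂ) (g i z))) z =
      ∑ i, ε i * (fderiv ℂ (f i) z (Pi.single j 1) * (starRingEnd ℂ) (g i z)) := by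
  simp only [wderiv, fderiv_real_sum_mul_conj_apply hf hg, fderiv_single_I, Finset.mul_sum,
    ← Finset.sum_sub_distrib, map_mul, conj_I]
  refine Finset.sum_congr rfl fun i _ => ?_
  linear_combination (-ε i / 2 * (fderiv ℂ (f i) z (Pi.single j 1) * (starRingEnd ℂ) (g i z)
    - f i z * (starRingEnd ℂ) (fderiv ℂ (g i) z (Pi.single j 1)))) * I_mul_I

theorem wderiv_congr {F G : (Fin n → ℂ) → ℂ} (h : F =ᶠ[𝓝 z] G) (j : Fin n) :
    wderiv j F z = wderiv j G z := by
  simp only [wderiv, h.fderiv_eq]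

end Wirtinger

theorem exists_hermC_eq_re {n : ℕ} {p : Fin n → ℂ} {J : Type*} [Fintype J]
    (F G : J → (Fin n → ℂ) → ℂ) (hF : ∀ j, AnalyticAt ℂ (F j) p)
    (hG : ∀ j, AnalyticAt ℂ (G j) p) (hF0 : ∀ j, F j p = 0) (hG0 : ∀ j, G j p = 0) :
    ∃ (m ℓ : ℕ) (α : Fin m → (Fin n → ℂ) → ℂ),
      ℓ ≤ m ∧ (∀ j, AnalyticAt ℂ (α j) p) ∧ (∀ j, α j p = 0) ∧
      ∀ z, hermC ℓ α z = ((∑ j, F j z * (starRingEnd ℂ) (G j z)).re : ℂ) := by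
  let e := Fintype.equivFin J
  let k := Fintype.card J
  refine ⟨k + k, k, Fin.append (fun i z => (1 / 2 : ℂ) * (F (e.symm i) z + G (e.symm i) z))
    (fun i z => (1 / 2 : ℂ) * (F (e.symm i) z - G (e.symm i) z)), by simp, ?_, ?_, ?_⟩
  · refine Fin.addCases (fun i => ?_) (fun i => ?_)
    · rw [Fin.append_left]
      exact analyticAt_const.mul ((hF _).add (hG _))
    · rw [Fin.append_right]
      exact analyticAt_const.mul ((hF _).sub (hG _))
  · refine Fin.addCases (fun i => ?_) (fun i => ?_)
    · simp [Fin.append_left, hF0, hG0]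
    · rw [Fin.append_right]
      simp [hF0, hG0]
  · intro z
    rw [hermC, Fin.sum_univ_add, ← Finset.sum_add_distrib, Complex.re_sum, Complex.ofReal_sum,
      ← Equiv.sum_comp e.symm]
    refine Finset.sum_congr rfl fun i _ => ?_
    simp only [Fin.append_left, Fin.append_right, Fin.val_castAdd, Fin.is_lt, if_true,
      Fin.val_natAdd, Nat.not_lt.2 (Nat.le_add_right _ _), if_false, Complex.re_eq_add_conj,
      map_mul, map_add, map_sub, map_div₀, map_one, map_ofNat, Complex.conj_conj]
    ring

/-- The expansion of the determinant of a sesquilinear Gram-type matrix as a finite sum of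
products `F_j · conj G_j`. -/
theorem det_sum_mul_conj {n N : ℕ} (ε : Fin N → ℂ) (P Q : Fin n → Fin N → ℂ) :
    Matrix.det (Matrix.of fun a b => ∑ i, ε i * (P a i * (starRingEnd ℂ) (Q b i))) =
      ∑ j : Equiv.Perm (Fin n) × (Fin n → Fin N),
        ((((Equiv.Perm.sign j.1 : ℤ) : ℂ) * ∏ a, ε (j.2 a)) * ∏ a, P (j.1 a) (j.2 a)) *
          (starRingEnd ℂ) (∏ a, Q a (j.2 a)) := by
  rw [Matrix.det_apply', Fintype.sum_prod_type]
  refine Finset.sum_congr rfl fun σ _ => ?_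
  simp only [Matrix.of_apply, Finset.prod_univ_sum, Fintype.piFinset_univ, Finset.mul_sum,
    Finset.prod_mul_distrib, map_prod]
  refine Finset.sum_congr rfl fun k _ => ?_
  ring

/-- In Bochner form, the polarized Levi matrix with the second point frozen at `p` is the
identity. -/
theorem IsBochnerAt.sum_fderiv_mul_conj_fderiv {n N : ℕ} {p : Fin n → ℂ} {ε : Fin N → ℂ}
    {φ : Fin N → (Fin n → ℂ) → ℂ} (hφ : ∀ i, AnalyticAt ℂ (φ i) p)
    (h : IsBochnerAt (fun z => ∑ i, ε i * (φ i z * (starRingEnd ℂ) (φ i z))) p)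
    (a b : Fin n) :
    ∀ᶠ z in 𝓝 p, ∑ i, ε i * (fderiv ℂ (φ i) z (Pi.single a 1) *
      (starRingEnd ℂ) (fderiv ℂ (φ i) p (Pi.single b 1))) =
        (1 : Matrix (Fin n) (Fin n) ℂ) a b := by
  obtain ⟨E, U, V, hU, hV, hpU, hpV, hE, hDE, -, hR⟩ := h
  have hφd : ∀ᶠ z in 𝓝 p, ∀ i, DifferentiableAt ℂ (φ i) z :=
    eventually_all.2 fun i => (hφ i).eventually_analyticAt.mono fun z hz => hz.differentiableAt
  let ψ : Fin N → (Fin n → ℂ) → ℂ := fun i w => star (φ i (star w))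
  have hψd : ∀ᶠ w in 𝓝 (star p), ∀ i, DifferentiableAt ℂ (ψ i) w := by
    have hs : Tendsto (star : (Fin n → ℂ) → Fin n → ℂ) (𝓝 (star p)) (𝓝 p) :=
      continuous_star.tendsto' _ _ (star_star p)
    filter_upwards [hs.eventually hφd] with w hw i
    have := (hw i).star_star
    rw [star_star] at this
    exact this
  let Φ : (Fin n → ℂ) × (Fin n → ℂ) → ℂ := fun x => ∑ i, ε i * (φ i x.1 * ψ i x.2)
  have hzero : ∀ᶠ x in 𝓝 (p, star p), E x.1 x.2 - Φ x = 0 := by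
    apply eventually_eq_zero_of_eventually_eq_zero_star
    · have hUV : U ×ˢ V ∈ 𝓝 (p, star p) := prod_mem_nhds (hU.mem_nhds hpU) (hV.mem_nhds hpV)
      filter_upwards [eventually_mem_nhds_iff.2 hUV,
        continuousAt_fst.eventually hφd, continuousAt_snd.eventually hψd] with x hx h1 h2
      refine (hE.differentiableAt hx).sub (DifferentiableAt.fun_sum fun i _ => ?_)
      exact (((h1 i).comp x differentiableAt_fst).mul
        ((h2 i).comp x differentiableAt_snd)).const_mul _
    · filter_upwards [hDE] with z hz
      rw [← hz, sub_eq_zero]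
      simp [Φ, ψ]
  have hfirst : ∀ᶠ z in 𝓝 p, ∑ i, ε i * (φ i z *
      (starRingEnd ℂ) (fderiv ℂ (φ i) p (Pi.single b 1))) = z b - p b := by
    rw [nhds_prod_eq] at hzero
    filter_upwards [hzero.curry, hU.mem_nhds hpU] with z hz hzU
    have h1 := (hR z hzU).2
    have h2 : (fun w => E z w - ∑ j, (z j - p j) * (w j - (starRingEnd ℂ) (p j)))
        =ᶠ[𝓝 (star p)]
        fun w => ∑ i, ε i * (φ i z * ψ i w) -
          ∑ j, (z j - p j) * (w j - (starRingEnd ℂ) (p j)) := by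
      filter_upwards [hz] with w hw
      rw [sub_eq_zero.1 hw]
    rw [h2.fderiv_eq] at h1
    have h3 : ∀ i, HasFDerivAt (ψ i) _ (star p) := fun i =>
      (hφ i).differentiableAt.hasFDerivAt.star_star
    have h4 := (HasFDerivAt.fun_sum (u := Finset.univ) fun i _ =>
      (((h3 i).const_mul (φ i z)).const_mul (ε i))).sub
      (HasFDerivAt.fun_sum (u := Finset.univ) fun j _ =>
        (((ContinuousLinearMap.proj (R := ℂ) (φ := fun _ : Fin n => ℂ) j).hasFDerivAt
          (x := star p)).sub_const ((starRingEnd ℂ) (p j))).const_mul (z j - p j))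
    have h5 := DFunLike.congr_fun (h4.fderiv.symm.trans h1) (Pi.single b 1)
    have h6 : star (Pi.single b 1 : Fin n → ℂ) = Pi.single b 1 := by
      rw [← Pi.single_star, star_one]
    simpa [h6, Pi.single_apply, sub_eq_zero] using h5
  have hnear := hfirst.eventually_nhds
  filter_upwards [hnear, hφd] with z hz hzd
  have h1 := HasFDerivAt.fun_sum (u := Finset.univ) fun i _ =>
    (((hzd i).hasFDerivAt.mul_const
      ((starRingEnd ℂ) (fderiv ℂ (φ i) p (Pi.single b 1)))).const_mul (ε i))
  have h2 := ((ContinuousLinearMap.proj (R := ℂ) (φ := fun _ : Fin n => ℂ) b).hasFDerivAt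
    (x := z)).sub_const (p b)
  have h3 := DFunLike.congr_fun
    (h1.unique (h2.congr_of_eventuallyEq hz)) (Pi.single a 1)
  simpa [Pi.single_apply, Matrix.one_apply, mul_comm, eq_comm]
    using h3

/-- Flat case of Proposition `mainprop`: if `D = Σ_{i<s}|φ_i|² − Σ_{i≥s}|φ_i|²` is in
Bochner form at `p`, then `det[∂²D/∂z_a ∂z̄_b] ∈ Λ̃_p`. -/
theorem stmt3 {n N : ℕ} (p : Fin n → ℂ) (s : ℕ) (hs : s ≤ N)
    (φ : Fin N → (Fin n → ℂ) → ℂ)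
    (hφ : ∀ i, AnalyticAt ℂ (φ i) p) (hφ0 : ∀ i, φ i p = 0)
    (D : (Fin n → ℂ) → ℂ)
    (hD : ∀ z, D z = ∑ i : Fin N, (if (i : ℕ) < s then (1 : ℂ) else -1) *
      (φ i z * (starRingEnd ℂ) (φ i z)))
    (hBochner : IsBochnerAt D p) :
    ∃ (a : ℝ) (m : ℕ) (ℓ : ℕ) (α : Fin m → (Fin n → ℂ) → ℂ),
      ℓ ≤ m ∧ (∀ j, AnalyticAt ℂ (α j) p) ∧ (∀ j, α j p = 0) ∧
      ∀ᶠ z in 𝓝 p,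
        Matrix.det (Matrix.of fun a b : Fin n => wderiv a (wderivBar b D) z) =
          (a : ℂ) + hermC ℓ α z := by
  obtain ⟨ε, hε⟩ : ∃ ε : Fin N → ℂ, ε = fun i : Fin N => if (i : ℕ) < s then (1 : ℂ) else -1 := ⟨_, rfl⟩
  have hεr : ∀ i, (starRingEnd ℂ) (ε i) = ε i := by
    intro i
    rw [hε]
    dsimp only
    split_ifs <;> simp
  obtain rfl : D = fun z => ∑ i, ε i * (φ i z * (starRingEnd ℂ) (φ i z)) := by
    ext z
    rw [hD, hε]
  let P : (Fin n → ℂ) → Fin n → Fin N → ℂ := fun z a i => fderiv ℂ (φ i) z (Pi.single a 1)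
  let M : (Fin n → ℂ) → (Fin n → ℂ) → Matrix (Fin n) (Fin n) ℂ := fun z w =>
    Matrix.of fun a b => ∑ i, ε i * (P z a i * (starRingEnd ℂ) (P w b i))
  have hMstar : ∀ z w, (M z w).conjTranspose = M w z := by
    intro z w
    ext a b
    simp [M, hεr, mul_comm]
  have hM1 : ∀ᶠ z in 𝓝 p, M z p = 1 := by
    filter_upwards [eventually_all.2 fun a => eventually_all.2 fun b =>
      hBochner.sum_fderiv_mul_conj_fderiv hφ a b] with z hz
    ext a b
    exact hz a b
  have hPan : ∀ a i, AnalyticAt ℂ (fun z => P z a i) p := fun a i =>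
    ((ContinuousLinearMap.apply ℂ ℂ (Pi.single a 1 : Fin n → ℂ)).analyticAt _).comp
      (hφ i).fderiv
  have hφd : ∀ᶠ z in 𝓝 p, ∀ i, AnalyticAt ℂ (φ i) z :=
    eventually_all.2 fun i => (hφ i).eventually_analyticAt
  have hlevi : ∀ᶠ z in 𝓝 p, (Matrix.of fun a b : Fin n => wderiv a (wderivBar b
      fun z => ∑ i, ε i * (φ i z * (starRingEnd ℂ) (φ i z))) z) = M z z := by
    filter_upwards [hφd.eventually_nhds] with z hz
    ext a b
    have h1 : wderivBar b (fun z => ∑ i, ε i * (φ i z * (starRingEnd ℂ) (φ i z))) =ᶠ[𝓝 z]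
        fun z => ∑ i, ε i * (φ i z * (starRingEnd ℂ) (P z b i)) := by
      filter_upwards [hz] with w hw
      exact wderivBar_sum_mul_conj (fun i => (hw i).differentiableAt)
        (fun i => (hw i).differentiableAt) b
    rw [Matrix.of_apply, wderiv_congr h1]
    refine wderiv_sum_mul_conj (g := fun i z => P z b i)
      (fun i => (hz.self_of_nhds i).differentiableAt) (fun i => ?_) a
    exact (hz.self_of_nhds i).fderiv.differentiableAt.clm_apply (differentiableAt_const _)
  let F : Equiv.Perm (Fin n) × (Fin n → Fin N) → (Fin n → ℂ) → ℂ := fun j z =>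
    (((Equiv.Perm.sign j.1 : ℤ) : ℂ) * ∏ a, ε (j.2 a)) * ∏ a, P z (j.1 a) (j.2 a)
  let G : Equiv.Perm (Fin n) × (Fin n → Fin N) → (Fin n → ℂ) → ℂ := fun j z =>
    ∏ a, P z a (j.2 a)
  have hdet : ∀ z w, (M z w).det = ∑ j, F j z * (starRingEnd ℂ) (G j w) := fun z w =>
    det_sum_mul_conj ε (P z) (P w)
  have hF : ∀ j, AnalyticAt ℂ (F j) p := fun j =>
    analyticAt_const.mul (Finset.analyticAt_fun_prod _ fun a _ => hPan _ _)
  have hG : ∀ j, AnalyticAt ℂ (G j) p := fun j =>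
    Finset.analyticAt_fun_prod _ fun a _ => hPan _ _
  obtain ⟨m, ℓ, α, hℓ, hα, hα0, h⟩ := exists_hermC_eq_re (p := p)
    (fun j z => F j z - F j p) (fun j z => G j z - G j p)
    (fun j => (hF j).sub analyticAt_const) (fun j => (hG j).sub analyticAt_const)
    (fun j => sub_self _) (fun j => sub_self _)
  refine ⟨1, m, ℓ, α, hℓ, hα, hα0, ?_⟩
  filter_upwards [hlevi, hM1] with z hz hz1
  have hsum : ∑ j, (F j z - F j p) * (starRingEnd ℂ) (G j z - G j p) = (M z z).det - 1 := by
    have e1 : ∑ j, F j z * (starRingEnd ℂ) (G j p) = 1 := by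
      rw [← hdet, hz1, Matrix.det_one]
    have e2 : ∑ j, F j p * (starRingEnd ℂ) (G j z) = 1 := by
      rw [← hdet, ← hMstar, hz1, Matrix.conjTranspose_one, Matrix.det_one]
    have e3 : ∑ j, F j p * (starRingEnd ℂ) (G j p) = 1 := by
      rw [← hdet, hM1.self_of_nhds, Matrix.det_one]
    simp only [map_sub, sub_mul, mul_sub, Finset.sum_sub_distrib, e1, e2, e3, hdet]
    ring
  have hreal : (((M z z).det - 1).re : ℂ) = (M z z).det - 1 := by
    apply Complex.conj_eq_iff_re.1
    rw [map_sub, map_one, starRingEnd_apply, ← Matrix.det_conjTranspose, hMstar]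
  rw [hz, h, hsum, hreal]
  push_cast
  ring
end

section
/- Let c be a nonzero real number, p ∈ ℂ^n, and let φ₁,…,φ_N be holomorphic functions on a neighborhood of p with φ_i(p) = 0 for all i, and 0 ≤ s ≤ N. Suppose 1 + (c/|c|)·(Σ_{i=1}^s |φ_i(z)|² − Σ_{i=s+1}^N |φ_i(z)|²) is positive on a neighborhood of p, set D = (2/c) log(1 + (c/|c|)(Σ_{i≤s}|φ_i|² − Σ_{i>s}|φ_i|²)), and assume D is in Bochner form at p. Then det[∂²D/∂z_a ∂z̄_b]_{a,b=1,…,n} belongs to K̃_p: there exist reals a, a' and tuples α, α' of holomorphic functions vanishing at p such that a' + ⟨α',α'⟩_{ℓ'} does not vanish at p and det[∂²D/∂z_a ∂z̄_b] = (a + ⟨α,α⟩_ℓ)/(a' + ⟨α',α'⟩_{ℓ'}) on a neighborhood of p. -/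
open Filter Topology Complex

/-- Functions that near `p` have the form `a + ∑ j, u j * conj (v j)` with `u j`, `v j`
holomorphic and vanishing at `p`. -/
def sesquiSubalgebra {n : ℕ} (p : Fin n → ℂ) : Subalgebra ℂ ((Fin n → ℂ) → ℂ) where
  carrier := {h | ∃ (a : ℂ) (ι : Type) (_ : Fintype ι) (u v : ι → (Fin n → ℂ) → ℂ),
    (∀ j, AnalyticAt ℂ (u j) p ∧ u j p = 0 ∧ AnalyticAt ℂ (v j) p ∧ v j p = 0) ∧
    ∀ᶠ z in 𝓝 p, h z = a + ∑ j, u j z * (starRingEnd ℂ) (v j z)}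
  algebraMap_mem' a := ⟨a, PEmpty, inferInstance, nofun, nofun, nofun, by simp⟩
  add_mem' := by
    rintro g h ⟨a, ι, _, u, v, huv, hg⟩ ⟨b, κ, _, u', v', huv', hh⟩
    refine ⟨a + b, ι ⊕ κ, inferInstance, Sum.elim u u', Sum.elim v v', ?_, ?_⟩
    · rintro (j | j)
      · exact huv j
      · exact huv' j
    · filter_upwards [hg, hh] with z h1 h2
      simp only [Pi.add_apply, h1, h2, Fintype.sum_sum_type, Sum.elim_inl, Sum.elim_inr]
      ring
  mul_mem' := by
    rintro g h ⟨a, ι, _, u, v, huv, hg⟩ ⟨b, κ, _, u', v', huv', hh⟩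
    refine ⟨a * b, ι ⊕ κ ⊕ ι × κ, inferInstance,
      Sum.elim (fun j z => b * u j z)
        (Sum.elim (fun j z => a * u' j z) (fun jk z => u jk.1 z * u' jk.2 z)),
      Sum.elim v (Sum.elim v' (fun jk z => v jk.1 z * v' jk.2 z)), ?_, ?_⟩
    · rintro (j | j | ⟨j, k⟩)
      · obtain ⟨h1, h2, h3, h4⟩ := huv j
        exact ⟨analyticAt_const.mul h1, by simp [h2], h3, h4⟩
      · obtain ⟨h1, h2, h3, h4⟩ := huv' j
        exact ⟨analyticAt_const.mul h1, by simp [h2], h3, h4⟩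
      · obtain ⟨h1, h2, h3, h4⟩ := huv j
        obtain ⟨h1', h2', h3', h4'⟩ := huv' k
        exact ⟨h1.mul h1', by simp [h2], h3.mul h3', by simp [h4]⟩
    · filter_upwards [hg, hh] with z h1 h2
      simp only [Pi.mul_apply, h1, h2, Fintype.sum_sum_type, Sum.elim_inl, Sum.elim_inr,
        Fintype.sum_prod_type, map_mul]
      have e : ∑ j, ∑ k, u j z * u' k z * ((starRingEnd ℂ) (v j z) * (starRingEnd ℂ) (v' k z))
          = (∑ j, u j z * (starRingEnd ℂ) (v j z)) * ∑ k, u' k z * (starRingEnd ℂ) (v' k z) := by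
        rw [Finset.sum_mul_sum]
        exact Finset.sum_congr rfl fun j _ => Finset.sum_congr rfl fun k _ => by ring
      rw [e]
      simp only [mul_assoc, ← Finset.mul_sum]
      ring

lemma sesquiSubalgebra_congr {n : ℕ} {p : Fin n → ℂ} {g h : (Fin n → ℂ) → ℂ}
    (hg : g ∈ sesquiSubalgebra p) (hgh : h =ᶠ[𝓝 p] g) : h ∈ sesquiSubalgebra p := by
  obtain ⟨a, ι, _, u, v, huv, hg⟩ := hg
  exact ⟨a, ι, _, u, v, huv, hgh.trans hg⟩

lemma mul_conj_mem_sesquiSubalgebra {n : ℕ} {p : Fin n → ℂ} {u v : (Fin n → ℂ) → ℂ}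
    (hu : AnalyticAt ℂ u p) (hu0 : u p = 0) (hv : AnalyticAt ℂ v p) (hv0 : v p = 0) :
    (fun z => u z * (starRingEnd ℂ) (v z)) ∈ sesquiSubalgebra p :=
  ⟨0, Unit, inferInstance, fun _ => u, fun _ => v, fun _ => ⟨hu, hu0, hv, hv0⟩, by simp⟩

lemma det_mem_sesquiSubalgebra {n k : ℕ} {p : Fin n → ℂ}
    {M : Fin k → Fin k → (Fin n → ℂ) → ℂ} (hM : ∀ a b, M a b ∈ sesquiSubalgebra p) :
    (fun z => Matrix.det (Matrix.of fun a b => M a b z)) ∈ sesquiSubalgebra p := by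
  have e : (fun z => Matrix.det (Matrix.of fun a b => M a b z)) =
      ∑ σ : Equiv.Perm (Fin k), (((Equiv.Perm.sign σ : ℤ) : ℂ)) • ∏ i, M (σ i) i := by
    ext z
    simp [Matrix.det_apply', Finset.sum_apply, Finset.prod_apply]
  rw [e]
  exact sum_mem fun σ _ => Subalgebra.smul_mem _ (prod_mem fun i _ => hM _ _) _

/-- A real-valued element of `sesquiSubalgebra p` lies in `Λ̃_p`. -/
lemma exists_hermC_of_mem_sesquiSubalgebra {n : ℕ} {p : Fin n → ℂ} {h : (Fin n → ℂ) → ℂ}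
    (hh : h ∈ sesquiSubalgebra p) (hreal : ∀ᶠ z in 𝓝 p, (starRingEnd ℂ) (h z) = h z) :
    ∃ (a : ℝ) (m ℓ : ℕ) (α : Fin m → (Fin n → ℂ) → ℂ), ℓ ≤ m ∧
      (∀ j, AnalyticAt ℂ (α j) p) ∧ (∀ j, α j p = 0) ∧
      ∀ᶠ z in 𝓝 p, h z = (a : ℂ) + hermC ℓ α z := by
  obtain ⟨a, ι, _, u, v, huv, hh⟩ := hh
  let e := Fintype.equivFin ι
  refine ⟨a.re, Fintype.card ι + Fintype.card ι, Fintype.card ι,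
    Fin.append (fun j z => (u (e.symm j) z + v (e.symm j) z) / 2)
      (fun j z => (u (e.symm j) z - v (e.symm j) z) / 2), by omega, ?_, ?_, ?_⟩
  · intro j
    refine Fin.addCases (fun j => ?_) (fun j => ?_) j
    · rw [Fin.append_left]
      exact ((huv _).1.add (huv _).2.2.1).div_const
    · rw [Fin.append_right]
      exact ((huv _).1.sub (huv _).2.2.1).div_const
  · intro j
    refine Fin.addCases (fun j => ?_) (fun j => ?_) j
    · simp [(huv _).2.1, (huv _).2.2.2]
    · rw [Fin.append_right]
      simp [(huv _).2.1, (huv _).2.2.2]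
  · filter_upwards [hh, hreal] with z h1 h2
    have h3 : h z = (h z + (starRingEnd ℂ) (h z)) / 2 := by rw [h2]; ring
    have h4 : (a.re : ℂ) = (a + (starRingEnd ℂ) a) / 2 := by
      rw [Complex.add_conj]; push_cast; ring
    rw [h3, h1, h4]
    simp only [hermC, Fin.sum_univ_add, Fin.append_left, Fin.append_right, Fin.val_castAdd,
      Fin.is_lt, if_true, Fin.val_natAdd, map_add, map_sum, map_mul, map_div₀, map_sub,
      Complex.conj_conj, not_lt.mpr (Nat.le_add_right _ _), if_false]
    rw [← e.symm.sum_comp (fun j => u j z * _), ← e.symm.sum_comp (fun j => _ * v j z),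
      ← Finset.sum_add_distrib]
    have h5 : ∀ A B C E : ℂ, (A + B + (C + E)) / 2 = (A + C) / 2 + (B + E) / 2 := by
      intros; ring
    rw [h5, ← Finset.sum_add_distrib, Finset.sum_div]
    congr 1
    refine Finset.sum_congr rfl fun j _ => ?_
    have : (starRingEnd ℂ) 2 = 2 := Complex.conj_ofNat 2
    rw [this]
    ring

/-- Identity theorem on a polydisc along its real points. -/
lemma eq_zero_of_eq_zero_on_real_s5 {ι : Type*} [Fintype ι] [DecidableEq ι]
    {g : (ι → ℂ) → ℂ} {r : ℝ} (hr : 0 < r) (hg : DifferentiableOn ℂ g (Metric.ball 0 r))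
    (h0 : ∀ x ∈ Metric.ball (0 : ι → ℂ) r, (∀ i, (x i).im = 0) → g x = 0) :
    ∀ x ∈ Metric.ball (0 : ι → ℂ) r, g x = 0 := by
  suffices H : ∀ S : Finset ι, ∀ x ∈ Metric.ball (0 : ι → ℂ) r,
      (∀ i ∉ S, (x i).im = 0) → g x = 0 from
    fun x hx => H Finset.univ x hx (by simp)
  intro S
  induction S using Finset.induction_on with
  | empty => simpa using h0
  | insert j S _ ih =>
    intro x hx hxS
    have hmem : ∀ t ∈ Metric.ball (0 : ℂ) r,
        Function.update x j t ∈ Metric.ball (0 : ι → ℂ) r := by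
      intro t ht
      rw [mem_ball_zero_iff, pi_norm_lt_iff hr] at *
      intro i
      by_cases hi : i = j
      · subst hi; simpa using ht
      · simpa [hi] using hx i
    have hd : DifferentiableOn ℂ (fun t => g (Function.update x j t)) (Metric.ball 0 r) :=
      hg.comp (fun t _ => (hasDerivAt_update x j t).differentiableAt.differentiableWithinAt) hmem
    have han := hd.analyticOnNhd Metric.isOpen_ball
    have hfreq : ∃ᶠ t in 𝓝[≠] (0 : ℂ), g (Function.update x j t) = 0 := by
      have hlim : Tendsto (fun k : ℕ => (((r / 2) * (1 / ((k : ℝ) + 1)) : ℝ) : ℂ))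
          atTop (𝓝[≠] 0) := by
        refine tendsto_nhdsWithin_iff.mpr ⟨?_, Eventually.of_forall fun k => ?_⟩
        · have := (tendsto_one_div_add_atTop_nhds_zero_nat (𝕜 := ℝ)).const_mul (r / 2)
          rw [mul_zero] at this
          have h := (Complex.continuous_ofReal.tendsto 0).comp this
          rw [Complex.ofReal_zero] at h
          exact h
        · have : (0 : ℝ) < r / 2 * (1 / ((k : ℝ) + 1)) := by positivity
          simpa only [Set.mem_compl_iff, Set.mem_singleton_iff, Complex.ofReal_eq_zero]
            using this.ne'
      refine hlim.frequently (Eventually.of_forall fun k => ih _ (hmem _ ?_) ?_).frequently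
      · have h1 : (0 : ℝ) < r / 2 * (1 / ((k : ℝ) + 1)) := by positivity
        rw [mem_ball_zero_iff, Complex.norm_real, Real.norm_of_nonneg h1.le]
        have : 1 / ((k : ℝ) + 1) ≤ 1 := by
          rw [div_le_one (by positivity)]
          linarith [Nat.cast_nonneg (α := ℝ) k]
        nlinarith
      · intro i hi
        by_cases hij : i = j
        · subst hij; simp
        · simpa [hij] using hxS i (by simp [hij, hi])
    have := han.eqOn_zero_of_preconnected_of_frequently_eq_zero
      (convex_ball _ _).isPreconnected (Metric.mem_ball_self hr) hfreq
    have hxj : x j ∈ Metric.ball (0 : ℂ) r := by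
      rw [mem_ball_zero_iff] at *
      exact (norm_le_pi_norm x j).trans_lt hx
    simpa using this hxj

/-- Polarization: a holomorphic function vanishing on `w = z̄` vanishes identically. -/
lemma eventually_eq_zero_of_eq_zero_on_conj {n : ℕ} {p : Fin n → ℂ}
    {G : (Fin n → ℂ) × (Fin n → ℂ) → ℂ}
    (hG : ∀ᶠ x in 𝓝 (p, star p), DifferentiableAt ℂ G x)
    (h0 : ∀ᶠ z in 𝓝 p, G (z, star z) = 0) :
    ∀ᶠ x in 𝓝 (p, star p), G x = 0 := by
  let Ψ : (Fin n ⊕ Fin n → ℂ) → (Fin n → ℂ) × (Fin n → ℂ) := fun x =>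
    (fun i => p i + (x (Sum.inl i) + Complex.I * x (Sum.inr i)),
      fun i => star (p i) + (x (Sum.inl i) - Complex.I * x (Sum.inr i)))
  let Φ : (Fin n → ℂ) × (Fin n → ℂ) → (Fin n ⊕ Fin n → ℂ) := fun y =>
    Sum.elim (fun i => ((y.1 i - p i) + (y.2 i - star (p i))) / 2)
      (fun i => ((y.1 i - p i) - (y.2 i - star (p i))) / (2 * Complex.I))
  have hΨd : Differentiable ℂ Ψ := by
    refine Differentiable.prodMk ?_ ?_ <;> refine differentiable_pi.mpr fun i => ?_ <;> fun_prop
  have hΨ0 : Ψ 0 = (p, star p) := by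
    ext i <;> simp [Ψ]
  have hΦ0 : Φ (p, star p) = 0 := by
    ext (i | i) <;> simp [Φ]
  have hΦc : Continuous Φ := by
    refine continuous_pi ?_
    rintro (i | i) <;> simp only [Φ, Sum.elim_inl, Sum.elim_inr] <;> fun_prop
  have hΨΦ : ∀ y, Ψ (Φ y) = y := by
    intro y
    have hI : Complex.I * (2 * Complex.I)⁻¹ = 1 / 2 := by
      field_simp
    ext i
    · simp only [Ψ, Φ, Sum.elim_inl, Sum.elim_inr, div_eq_mul_inv]
      linear_combination (y.1 i - p i - (y.2 i - star (p i))) * hI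
    · simp only [Ψ, Φ, Sum.elim_inl, Sum.elim_inr, div_eq_mul_inv]
      linear_combination -(y.1 i - p i - (y.2 i - star (p i))) * hI
  have h1 : ∀ᶠ x in 𝓝 (0 : Fin n ⊕ Fin n → ℂ), DifferentiableAt ℂ G (Ψ x) := by
    have := hΨd.continuous.tendsto 0
    rw [hΨ0] at this
    exact this.eventually hG
  have h2 : ∀ᶠ x in 𝓝 (0 : Fin n ⊕ Fin n → ℂ), G ((Ψ x).1, star (Ψ x).1) = 0 := by
    have := (continuous_fst.comp hΨd.continuous).tendsto 0
    simp only [Function.comp, hΨ0] at this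
    exact this.eventually h0
  obtain ⟨r, hr, hball⟩ := Metric.eventually_nhds_iff_ball.mp (h1.and h2)
  have key := eq_zero_of_eq_zero_on_real_s5 (g := G ∘ Ψ) hr
    (fun x hx => ((hball x hx).1.comp x (hΨd x)).differentiableWithinAt)
    (fun x hx hre => by
      have e : star (Ψ x).1 = (Ψ x).2 := by
        ext i
        have e1 : (starRingEnd ℂ) (x (Sum.inl i)) = x (Sum.inl i) :=
          Complex.conj_eq_iff_im.mpr (hre _)
        have e2 : (starRingEnd ℂ) (x (Sum.inr i)) = x (Sum.inr i) :=
          Complex.conj_eq_iff_im.mpr (hre _)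
        simp [Ψ, e1, e2, sub_eq_add_neg]
      have := (hball x hx).2
      rw [e] at this
      exact this)
  have h3 : ∀ᶠ y in 𝓝 (p, star p), Φ y ∈ Metric.ball (0 : Fin n ⊕ Fin n → ℂ) r := by
    have := hΦc.tendsto (p, star p)
    rw [hΦ0] at this
    exact this.eventually (Metric.ball_mem_nhds _ hr)
  filter_upwards [h3] with y hy
  simpa [hΨΦ] using key _ hy

lemma clm_single_I {n : ℕ} (L : (Fin n → ℂ) →L[ℂ] ℂ) (j : Fin n) :
    L (Pi.single j Complex.I) = Complex.I * L (Pi.single j 1) := by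
  rw [← smul_eq_mul, ← map_smul, ← Pi.single_smul, smul_eq_mul, mul_one]

lemma exists_hasFDerivAt_sum_mul_conj {n : ℕ} {ι : Type*} [Fintype ι] (w : ι → ℂ)
    {u v : ι → (Fin n → ℂ) → ℂ} {z : Fin n → ℂ}
    (hu : ∀ i, DifferentiableAt ℂ (u i) z) (hv : ∀ i, DifferentiableAt ℂ (v i) z) (k : ℂ) :
    ∃ L : (Fin n → ℂ) →L[ℝ] ℂ,
      HasFDerivAt (fun z => k + ∑ i, w i * (u i z * (starRingEnd ℂ) (v i z))) L z ∧
      ∀ h, L h = ∑ i, w i * (fderiv ℂ (u i) z h * (starRingEnd ℂ) (v i z) +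
        u i z * (starRingEnd ℂ) (fderiv ℂ (v i) z h)) := by
  have hd := (HasFDerivAt.fun_sum (u := Finset.univ) fun i _ =>
    (((hu i).hasFDerivAt.restrictScalars ℝ).mul
      ((hv i).hasFDerivAt.restrictScalars ℝ).star).const_mul (w i)).const_add k
  refine ⟨_, hd, fun h => ?_⟩
  rw [_root_.sum_apply]
  refine Finset.sum_congr rfl fun i _ => ?_
  simp
  ring

lemma wderiv_sum_mul_conj_s5 {n : ℕ} {ι : Type*} [Fintype ι] (w : ι → ℂ)
    {u v : ι → (Fin n → ℂ) → ℂ} {z : Fin n → ℂ}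
    (hu : ∀ i, DifferentiableAt ℂ (u i) z) (hv : ∀ i, DifferentiableAt ℂ (v i) z) (k : ℂ)
    (a : Fin n) :
    wderiv a (fun z => k + ∑ i, w i * (u i z * (starRingEnd ℂ) (v i z))) z =
      ∑ i, w i * (fderiv ℂ (u i) z (Pi.single a 1) * (starRingEnd ℂ) (v i z)) := by
  obtain ⟨L, hL, hLh⟩ := exists_hasFDerivAt_sum_mul_conj w hu hv k
  rw [wderiv, hL.fderiv, hLh, hLh, Finset.mul_sum, ← Finset.sum_sub_distrib, Finset.mul_sum]
  refine Finset.sum_congr rfl fun i _ => ?_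
  rw [clm_single_I, clm_single_I, map_mul, Complex.conj_I]
  ring_nf
  rw [Complex.I_sq]
  ring

lemma wderivBar_sum_mul_conj_s5 {n : ℕ} {ι : Type*} [Fintype ι] (w : ι → ℂ)
    {u v : ι → (Fin n → ℂ) → ℂ} {z : Fin n → ℂ}
    (hu : ∀ i, DifferentiableAt ℂ (u i) z) (hv : ∀ i, DifferentiableAt ℂ (v i) z) (k : ℂ)
    (b : Fin n) :
    wderivBar b (fun z => k + ∑ i, w i * (u i z * (starRingEnd ℂ) (v i z))) z =
      ∑ i, w i * (u i z * (starRingEnd ℂ) (fderiv ℂ (v i) z (Pi.single b 1))) := by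
  obtain ⟨L, hL, hLh⟩ := exists_hasFDerivAt_sum_mul_conj w hu hv k
  rw [wderivBar, hL.fderiv, hLh, hLh, Finset.mul_sum, ← Finset.sum_add_distrib, Finset.mul_sum]
  refine Finset.sum_congr rfl fun i _ => ?_
  rw [clm_single_I, clm_single_I, map_mul, Complex.conj_I]
  ring_nf
  rw [Complex.I_sq]
  ring

lemma wderivBar_const_mul_clog {n : ℕ} {F : (Fin n → ℂ) → ℂ} {z : Fin n → ℂ} (k : ℂ)
    (hF : DifferentiableAt ℝ F z) (hz : F z ∈ Complex.slitPlane) (b : Fin n) :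
    wderivBar b (fun z => k * Complex.log (F z)) z = k * (wderivBar b F z / F z) := by
  have h := (((Complex.hasDerivAt_log hz).hasFDerivAt.restrictScalars ℝ).comp z
    hF.hasFDerivAt).const_mul k
  rw [wderivBar, show fderiv ℝ (fun z => k * Complex.log (F z)) z = _ from h.fderiv, wderivBar]
  simp
  ring

lemma wderiv_const_mul_div {n : ℕ} {B F : (Fin n → ℂ) → ℂ} {z : Fin n → ℂ} (k : ℂ)
    (hB : DifferentiableAt ℝ B z) (hF : DifferentiableAt ℝ F z) (hz : F z ≠ 0) (a : Fin n) :
    wderiv a (fun z => k * (B z / F z)) z =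
      k / F z ^ 2 * (F z * wderiv a B z - B z * wderiv a F z) := by
  have h := (hB.hasFDerivAt.mul (((hasDerivAt_inv hz).hasFDerivAt.restrictScalars ℝ).comp z
    hF.hasFDerivAt)).const_mul k
  have e : (fun z => k * (B z / F z)) = fun z => k * (B z * (F z)⁻¹) := by
    ext; rw [div_eq_mul_inv]
  rw [wderiv, e, show fderiv ℝ (fun z => k * (B z * (F z)⁻¹)) z = _ from h.fderiv, wderiv, wderiv]
  simp
  field_simp
  ring

/-- If `exp (k D) = 1 + ∑ wᵢ |φᵢ|²` with `D` in Bochner form, then the part of `∂(∑ wᵢ |φᵢ|²)/∂z̄_b`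
holomorphic in `z` is `k (z_b - p_b)`. -/
lemma IsBochnerAt.sum_mul_conj_fderiv {n N : ℕ} {p : Fin n → ℂ} {D : (Fin n → ℂ) → ℂ}
    (hB : IsBochnerAt D p) {φ : Fin N → (Fin n → ℂ) → ℂ}
    (hφ : ∀ i, AnalyticAt ℂ (φ i) p) (w : Fin N → ℂ) (k : ℂ)
    (hexp : ∀ᶠ z in 𝓝 p, Complex.exp (k * D z) =
      1 + ∑ i, w i * (φ i z * (starRingEnd ℂ) (φ i z))) (b : Fin n) :
    ∀ᶠ z in 𝓝 p, ∑ i, w i * (φ i z * (starRingEnd ℂ) (fderiv ℂ (φ i) p (Pi.single b 1))) =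
      k * (z b - p b) := by
  obtain ⟨E, U, V, hU, hV, hpU, hpV, hE, hDE, -, hR⟩ := hB
  have hEd : ∀ z ∈ U, ∀ w ∈ V, DifferentiableAt ℂ
      (fun zw : (Fin n → ℂ) × (Fin n → ℂ) => E zw.1 zw.2) (z, w) := fun z hz w hw =>
    hE.differentiableAt ((hU.prod hV).mem_nhds ⟨hz, hw⟩)
  have hφd : ∀ᶠ z in 𝓝 p, ∀ i, DifferentiableAt ℂ (φ i) z :=
    eventually_all.mpr fun i => (hφ i).eventually_analyticAt.mono fun z hz => hz.differentiableAt
  have hconj : Tendsto (fun w : Fin n → ℂ => star w) (𝓝 (star p)) (𝓝 p) := by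
    simpa using (continuous_star.tendsto (star p))
  have hpol := eventually_eq_zero_of_eq_zero_on_conj (p := p)
    (G := fun x => Complex.exp (k * E x.1 x.2) -
      (1 + ∑ i, w i * (φ i x.1 * (star ∘ φ i ∘ star) x.2))) (by
      rw [nhds_prod_eq]
      filter_upwards [((hU.eventually_mem hpU).and hφd).prod_mk
        ((hV.eventually_mem hpV).and (hconj.eventually hφd))] with x hx
      obtain ⟨⟨h1, h2⟩, h3, h4⟩ := hx
      have h5 : ∀ i, DifferentiableAt ℂ (star ∘ φ i ∘ star) x.2 := fun i => by
        simpa using (h4 i).star_star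
      have h6 : ∀ i, DifferentiableAt ℂ (fun x : (Fin n → ℂ) × (Fin n → ℂ) =>
          (star ∘ φ i ∘ star) x.2) x := fun i => (h5 i).comp x differentiableAt_snd
      have h7 : ∀ i, DifferentiableAt ℂ (fun x : (Fin n → ℂ) × (Fin n → ℂ) => φ i x.1) x :=
        fun i => (h2 i).comp x differentiableAt_fst
      exact ((hEd _ h1 _ h3).const_mul k).cexp.sub ((DifferentiableAt.fun_sum fun i _ =>
        ((h7 i).mul (h6 i)).const_mul (w i)).const_add 1)) (by
      filter_upwards [hDE, hexp] with z h1 h2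
      rw [← h1, h2, sub_eq_zero]
      simp)
  filter_upwards [hpol.curry_nhds, hU.mem_nhds hpU] with z hz hzU
  obtain ⟨hR0, hR1⟩ := hR z hzU
  have hq := HasFDerivAt.fun_sum (u := Finset.univ) (x := star p) fun (j : Fin n) _ =>
    ((hasFDerivAt_apply (𝕜 := ℂ) (F' := fun _ : Fin n => ℂ) j (star p)).sub_const
      ((starRingEnd ℂ) (p j))).const_mul (z j - p j)
  have hEz : DifferentiableAt ℂ (fun w => E z w) (star p) :=
    (hEd z hzU _ hpV).comp (star p)
      ((differentiableAt_const z).prodMk differentiableAt_id)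
  have hfd := hEz.hasFDerivAt
  have hEq : fderiv ℂ (fun w => E z w) (star p) = _ := sub_eq_zero.mp
    ((hfd.sub hq).fderiv.symm.trans hR1)
  rw [hEq] at hfd
  have hE0 : E z (star p) = 0 := by simpa using hR0
  have hS := (hfd.const_mul k).cexp.sub ((HasFDerivAt.fun_sum (u := Finset.univ)
    fun (i : Fin N) _ => (((hφ i).differentiableAt.hasFDerivAt.star_star).const_mul
      (φ i z)).const_mul (w i)).const_add 1)
  have h0 : HasFDerivAt (fun _ : Fin n → ℂ => (0 : ℂ)) (0 : (Fin n → ℂ) →L[ℂ] ℂ) (star p) :=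
    hasFDerivAt_const _ _
  have key := congrArg (fun L : (Fin n → ℂ) →L[ℂ] ℂ => L (Pi.single b 1))
    (hS.unique (h0.congr_of_eventuallyEq hz))
  have hst : star (Pi.single b (1 : ℂ)) = (Pi.single b 1 : Fin n → ℂ) := by
    rw [Pi.star_single]; simp
  simp [hE0, Pi.single_apply, hst, sub_eq_zero] at key
  simpa using key.symm

/-- Statement (detko) of Proposition `mainprop` for `c ≠ 0`: if
`D = (2/c) log (1 + (c/|c|)(Σ_{i<s}|φ_i|² − Σ_{i≥s}|φ_i|²))` is in Bochner form at `p`,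
then `det[∂²D/∂z_a ∂z̄_b]` lies in the field of fractions `K̃_p` of `Λ̃_p`. -/
theorem stmt5 {n N : ℕ} (c : ℝ) (hc : c ≠ 0) (p : Fin n → ℂ) (s : ℕ) (hs : s ≤ N)
    (φ : Fin N → (Fin n → ℂ) → ℂ)
    (hφ : ∀ i, AnalyticAt ℂ (φ i) p) (hφ0 : ∀ i, φ i p = 0)
    (f : (Fin n → ℂ) → ℝ)
    (hf : ∀ z, f z = 1 + (c / |c|) *
      ∑ i : Fin N, (if (i : ℕ) < s then (1 : ℝ) else -1) * Complex.normSq (φ i z))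
    (hfpos : ∀ᶠ z in 𝓝 p, 0 < f z)
    (D : (Fin n → ℂ) → ℂ)
    (hD : ∀ z, D z = (((2 / c) * Real.log (f z) : ℝ) : ℂ))
    (hBochner : IsBochnerAt D p) :
    ∃ (a a' : ℝ) (m m' : ℕ) (ℓ ℓ' : ℕ)
      (α : Fin m → (Fin n → ℂ) → ℂ) (α' : Fin m' → (Fin n → ℂ) → ℂ),
      ℓ ≤ m ∧ ℓ' ≤ m' ∧
      (∀ j, AnalyticAt ℂ (α j) p) ∧ (∀ j, α j p = 0) ∧
      (∀ j, AnalyticAt ℂ (α' j) p) ∧ (∀ j, α' j p = 0) ∧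
      ((a' : ℂ) + hermC ℓ' α' p ≠ 0) ∧
      ∀ᶠ z in 𝓝 p,
        Matrix.det (Matrix.of fun a b : Fin n => wderiv a (wderivBar b D) z) =
          ((a : ℂ) + hermC ℓ α z) / ((a' : ℂ) + hermC ℓ' α' z) := by
  set w : Fin N → ℂ := fun i => ((c / |c| * if (i : ℕ) < s then 1 else -1 : ℝ) : ℂ) with hw
  have hwconj : ∀ i, (starRingEnd ℂ) (w i) = w i := fun i => Complex.conj_ofReal _
  set F : (Fin n → ℂ) → ℂ := fun z => 1 + ∑ i, w i * (φ i z * (starRingEnd ℂ) (φ i z)) with hF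
  have hfF : ∀ z, (f z : ℂ) = F z := fun z => by
    simp only [hf, hF, hw, Complex.mul_conj, Finset.mul_sum]
    push_cast
    simp only [mul_assoc]
  have hcC : (c : ℂ) ≠ 0 := Complex.ofReal_ne_zero.mpr hc
  let dφ : Fin n → Fin N → (Fin n → ℂ) → ℂ := fun a i z => fderiv ℂ (φ i) z (Pi.single a 1)
  have hdφ : ∀ a i, AnalyticAt ℂ (dφ a i) p := fun a i =>
    ((ContinuousLinearMap.apply ℂ ℂ (Pi.single a (1 : ℂ) : Fin n → ℂ)).analyticAt _).comp
      (hφ i).fderiv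
  have hgood : ∀ᶠ z in 𝓝 p, (∀ i, DifferentiableAt ℂ (φ i) z) ∧
      (∀ a i, DifferentiableAt ℂ (dφ a i) z) ∧ 0 < f z := by
    refine (eventually_all.mpr fun i => ?_).and
      ((eventually_all.mpr fun a => eventually_all.mpr fun i => ?_).and hfpos)
    · exact (hφ i).eventually_analyticAt.mono fun z hz => hz.differentiableAt
    · exact (hdφ a i).eventually_analyticAt.mono fun z hz => hz.differentiableAt
  let A : Fin n → (Fin n → ℂ) → ℂ := fun a z =>
    ∑ i, w i * (dφ a i z * (starRingEnd ℂ) (φ i z))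
  let B : Fin n → (Fin n → ℂ) → ℂ := fun b z =>
    ∑ i, w i * (φ i z * (starRingEnd ℂ) (dφ b i z))
  let H : Fin n → Fin n → (Fin n → ℂ) → ℂ := fun a b z =>
    ∑ i, w i * (dφ a i z * (starRingEnd ℂ) (dφ b i z))
  let M : Fin n → Fin n → (Fin n → ℂ) → ℂ := fun a b => F * H a b - A a * B b
  have hFne : ∀ z, 0 < f z → F z ≠ 0 := fun z hz => by
    rw [← hfF]
    exact Complex.ofReal_ne_zero.mpr hz.ne'
  have hDlog : ∀ z, 0 < f z → D z = 2 / c * Complex.log (F z) := fun z hz => by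
    rw [hD, ← hfF, ← Complex.ofReal_log hz.le]
    push_cast
    rfl
  have hFd : ∀ z, (∀ i, DifferentiableAt ℂ (φ i) z) → DifferentiableAt ℝ F z := fun z h =>
    (exists_hasFDerivAt_sum_mul_conj w h h 1).choose_spec.1.differentiableAt
  have hDbar : ∀ᶠ z in 𝓝 p, ∀ b, wderivBar b D z = 2 / c * (B b z / F z) := by
    filter_upwards [hgood.eventually_nhds] with z hz b
    obtain ⟨h1, -, h3⟩ := hz.self_of_nhds
    have e : D =ᶠ[𝓝 z] fun z => 2 / c * Complex.log (F z) := hz.mono fun y hy => hDlog y hy.2.2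
    have e' : wderivBar b D z = wderivBar b (fun z => 2 / c * Complex.log (F z)) z := by
      rw [wderivBar, wderivBar, e.fderiv_eq]
    rw [e', wderivBar_const_mul_clog _ (hFd z h1)
      (by rw [← hfF]; exact Complex.ofReal_mem_slitPlane.mpr h3), wderivBar_sum_mul_conj_s5 w h1 h1]
  have hDab : ∀ᶠ z in 𝓝 p, ∀ a b, wderiv a (wderivBar b D) z = 2 / c / F z ^ 2 * M a b z := by
    filter_upwards [hgood, hDbar.eventually_nhds] with z hz hzD a b
    obtain ⟨h1, h2, h3⟩ := hz
    have e : wderivBar b D =ᶠ[𝓝 z] fun z => 2 / c * (B b z / F z) := hzD.mono fun y hy => hy b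
    have hB0 : B b = fun z => 0 + ∑ i, w i * (φ i z * (starRingEnd ℂ) (dφ b i z)) := by
      ext; rw [zero_add]
    have hBd : DifferentiableAt ℝ (B b) z := by
      rw [hB0]
      exact (exists_hasFDerivAt_sum_mul_conj w h1 (h2 b) 0).choose_spec.1.differentiableAt
    have e' : wderiv a (wderivBar b D) z = wderiv a (fun z => 2 / c * (B b z / F z)) z := by
      rw [wderiv, wderiv, e.fderiv_eq]
    have hBa : wderiv a (B b) z = H a b z := by
      rw [hB0, wderiv_sum_mul_conj_s5 w h1 (h2 b)]
    have hFa : wderiv a F z = A a z := wderiv_sum_mul_conj_s5 w h1 h1 1 a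
    rw [e', wderiv_const_mul_div _ hBd (hFd z h1) (hFne z h3), hBa, hFa]
    simp only [M, Pi.sub_apply, Pi.mul_apply]
    ring
  have hexp : ∀ᶠ z in 𝓝 p, Complex.exp (c / 2 * D z) =
      1 + ∑ i, w i * (φ i z * (starRingEnd ℂ) (φ i z)) := by
    filter_upwards [hfpos] with z hz
    rw [hDlog z hz, show (c / 2 * (2 / c * Complex.log (F z)) : ℂ) = Complex.log (F z) by
      field_simp, Complex.exp_log (hFne z hz)]
  have hpolar : ∀ b, ∀ᶠ z in 𝓝 p, ∑ i, w i * (φ i z * (starRingEnd ℂ) (dφ b i p)) =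
      c / 2 * (z b - p b) := hBochner.sum_mul_conj_fderiv hφ w (c / 2) hexp
  have hconst : ∀ a b, ∀ᶠ z in 𝓝 p, ∑ i, w i * (dφ a i z * (starRingEnd ℂ) (dφ b i p)) =
      c / 2 * (Pi.single a (1 : ℂ) : Fin n → ℂ) b := by
    intro a b
    filter_upwards [hgood, (hpolar b).eventually_nhds] with z hz hzb
    have h1 := HasFDerivAt.fun_sum (u := Finset.univ) fun (i : Fin N) _ =>
      ((hz.1 i).hasFDerivAt.mul_const ((starRingEnd ℂ) (dφ b i p))).const_mul (w i)
    have h2 := ((hasFDerivAt_apply (𝕜 := ℂ) (F' := fun _ : Fin n => ℂ) b z).sub_const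
      (p b)).const_mul (c / 2 : ℂ)
    have key := congrArg (fun L : (Fin n → ℂ) →L[ℂ] ℂ => L (Pi.single a 1))
      (h1.unique (h2.congr_of_eventuallyEq hzb))
    simp only [_root_.sum_apply, _root_.smul_apply, smul_eq_mul,
      ContinuousLinearMap.proj_apply] at key
    rw [← key]
    exact Finset.sum_congr rfl fun i _ => by rw [mul_comm (dφ a i z)]
  have hFmem : F ∈ sesquiSubalgebra p := by
    have e : F = 1 + ∑ i, w i • fun z => φ i z * (starRingEnd ℂ) (φ i z) := by
      ext z; simp [hF]
    rw [e]
    exact add_mem (one_mem _) (sum_mem fun i _ => Subalgebra.smul_mem _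
      (mul_conj_mem_sesquiSubalgebra (hφ i) (hφ0 i) (hφ i) (hφ0 i)) _)
  have hABmem : ∀ a b, A a * B b ∈ sesquiSubalgebra p := by
    intro a b
    have e : A a * B b = ∑ i, ∑ j, (w i * w j) • fun z =>
        (dφ a i z * φ j z) * (starRingEnd ℂ) (φ i z * dφ b j z) := by
      ext z
      simp only [A, B, Pi.mul_apply, Finset.sum_mul_sum, Finset.sum_apply, Pi.smul_apply,
        smul_eq_mul, map_mul]
      exact Finset.sum_congr rfl fun i _ => Finset.sum_congr rfl fun j _ => by ring
    rw [e]
    exact sum_mem fun i _ => sum_mem fun j _ => Subalgebra.smul_mem _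
      (mul_conj_mem_sesquiSubalgebra ((hdφ a i).mul (hφ j)) (by simp [hφ0])
        ((hφ i).mul (hdφ b j)) (by simp [hφ0])) _
  have hHmem : ∀ a b, H a b ∈ sesquiSubalgebra p := by
    intro a b
    let K : ℂ := c / 2 * (Pi.single a (1 : ℂ) : Fin n → ℂ) b +
      (starRingEnd ℂ) (c / 2 * (Pi.single b (1 : ℂ) : Fin n → ℂ) a) -
      ∑ i, w i * (dφ a i p * (starRingEnd ℂ) (dφ b i p))
    have hmem : (∑ i, w i • fun z => (dφ a i z - dφ a i p) *
        (starRingEnd ℂ) (dφ b i z - dφ b i p)) + algebraMap ℂ _ K ∈ sesquiSubalgebra p :=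
      add_mem (sum_mem fun i _ => Subalgebra.smul_mem _ (mul_conj_mem_sesquiSubalgebra
        ((hdφ a i).sub analyticAt_const) (sub_self _)
        ((hdφ b i).sub analyticAt_const) (sub_self _)) _) (Subalgebra.algebraMap_mem _ _)
    refine sesquiSubalgebra_congr hmem ?_
    filter_upwards [hconst a b, hconst b a] with z h1 h2
    simp only [Pi.add_apply, Finset.sum_apply, Pi.smul_apply, smul_eq_mul, Pi.algebraMap_apply,
      Algebra.algebraMap_self, RingHom.id_apply, K]
    rw [← h1, ← h2, map_sum, ← Finset.sum_add_distrib, ← Finset.sum_sub_distrib,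
      ← Finset.sum_add_distrib]
    refine Finset.sum_congr rfl fun i _ => ?_
    simp only [map_mul, map_sub, hwconj, Complex.conj_conj]
    ring
  have hFconj : ∀ z, (starRingEnd ℂ) (F z) = F z := fun z => by
    rw [← hfF, Complex.conj_ofReal]
  have hMconj : ∀ a b z, (starRingEnd ℂ) (M a b z) = M b a z := by
    intro a b z
    have hH : (starRingEnd ℂ) (H a b z) = H b a z := by
      simp only [H, map_sum, map_mul, hwconj, Complex.conj_conj]
      exact Finset.sum_congr rfl fun i _ => by ring
    have hA : ∀ a, (starRingEnd ℂ) (A a z) = B a z := fun a => by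
      simp only [A, B, map_sum, map_mul, hwconj, Complex.conj_conj]
      exact Finset.sum_congr rfl fun i _ => by ring
    have hB : (starRingEnd ℂ) (B b z) = A b z := by rw [← hA, Complex.conj_conj]
    simp only [M, Pi.sub_apply, Pi.mul_apply, map_sub, map_mul, hFconj, hH, hA, hB]
    ring
  have hMdet : ∀ z, (starRingEnd ℂ) (Matrix.det (Matrix.of fun a b => M a b z)) =
      Matrix.det (Matrix.of fun a b => M a b z) := by
    intro z
    rw [starRingEnd_apply, ← Matrix.det_conjTranspose]
    congr 1
    ext a b
    exact hMconj b a z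
  obtain ⟨a, m, ℓ, α, hℓ, hα, hα0, hnum⟩ := exists_hermC_of_mem_sesquiSubalgebra
    (h := (((2 / c) ^ n : ℝ) : ℂ) • fun z => Matrix.det (Matrix.of fun a b => M a b z))
    (Subalgebra.smul_mem _ (det_mem_sesquiSubalgebra fun a b =>
      sub_mem (mul_mem hFmem (hHmem a b)) (hABmem a b)) _)
    (Eventually.of_forall fun z => by
      rw [Pi.smul_apply, smul_eq_mul, map_mul, hMdet, Complex.conj_ofReal])
  obtain ⟨a', m', ℓ', α', hℓ', hα', hα0', hden⟩ := exists_hermC_of_mem_sesquiSubalgebra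
    (pow_mem hFmem (2 * n)) (Eventually.of_forall fun z => by rw [Pi.pow_apply, map_pow, hFconj])
  refine ⟨a, a', m, m', ℓ, ℓ', α, α', hℓ, hℓ', hα, hα0, hα', hα0', ?_, ?_⟩
  · rw [← hden.self_of_nhds]
    exact pow_ne_zero _ (hFne p hfpos.self_of_nhds)
  · filter_upwards [hDab, hnum, hden] with z h1 h2 h3
    rw [← h2, ← h3]
    have e : (Matrix.of fun a b : Fin n => wderiv a (wderivBar b D) z) =
        (2 / c / F z ^ 2 : ℂ) • Matrix.of fun a b => M a b z := by
      ext a b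
      simp [h1]
    rw [e, Matrix.det_smul, Fintype.card_fin, Pi.smul_apply, Pi.pow_apply, smul_eq_mul, pow_mul,
      div_pow]
    push_cast
    ring
end
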